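/- arXiv:2310.05509 — 7 statements merged into one kernel-verified Lean document; each statement's English description precedes it below -/
import Mathlib

section
/- Assume b1 = 0 and b2 = 0. Define H(x,y) = (-1 + a2*x^3 - 3*a1*x^2*y - (2*a1 + a3)*y^3) / (3*(x^2 + y^2)^(3/2)). Then H is a first integral of the rigid system (E) away from the origin: for every solution f : I -> R^2 of (E) on an interval I with f(t) ≠ (0,0) for all t in I, the function t ↦ H(f(t)) is constant on I. -/
/-- The function `F` of the rigid system. -/
noncomputable def Ffun (b1 b2 a1 a2 a3 x y : ℝ) : ℝ :=
  b1*x + b2*y + a1*x^3 + a2*x^2*y + a3*x*y^2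

/-- First component of the rigid vector field. -/
noncomputable def Pfun (b1 b2 a1 a2 a3 x y : ℝ) : ℝ :=
  -y + x * Ffun b1 b2 a1 a2 a3 x y

/-- Second component of the rigid vector field. -/
noncomputable def Qfun (b1 b2 a1 a2 a3 x y : ℝ) : ℝ :=
  x + y * Ffun b1 b2 a1 a2 a3 x y

/-- `f : ℝ → ℝ × ℝ` is a solution of the rigid system (E) on the interval `I`. -/
def IsSolutionOnE (b1 b2 a1 a2 a3 : ℝ) (f : ℝ → ℝ × ℝ) (I : Set ℝ) : Prop :=
  ∀ t ∈ I, HasDerivWithinAt f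
    (Pfun b1 b2 a1 a2 a3 (f t).1 (f t).2, Qfun b1 b2 a1 a2 a3 (f t).1 (f t).2) I t

/-- The first integral `H` for the homogeneous case `b1 = b2 = 0`. -/
noncomputable def Hfun (a1 a2 a3 x y : ℝ) : ℝ :=
  (-1 + a2*x^3 - 3*a1*x^2*y - (2*a1 + a3)*y^3) / (3 * Real.sqrt ((x^2 + y^2)^3))

/-- The numerator of `Hfun` is an invariant function of the vector field with cofactor `3 F`. -/
theorem hasDerivWithinAt_numerator {a1 a2 a3 t : ℝ} {I : Set ℝ} {x y : ℝ → ℝ}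
    (hx : HasDerivWithinAt x (Pfun 0 0 a1 a2 a3 (x t) (y t)) I t)
    (hy : HasDerivWithinAt y (Qfun 0 0 a1 a2 a3 (x t) (y t)) I t) :
    HasDerivWithinAt
      (fun s => -1 + a2 * x s ^ 3 - 3 * a1 * x s ^ 2 * y s - (2 * a1 + a3) * y s ^ 3)
      (3 * Ffun 0 0 a1 a2 a3 (x t) (y t) *
        (-1 + a2 * x t ^ 3 - 3 * a1 * x t ^ 2 * y t - (2 * a1 + a3) * y t ^ 3)) I t := by
  refine (((((hx.fun_pow 3).const_mul a2).const_add (-1)).fun_sub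
    (((hx.fun_pow 2).const_mul (3 * a1)).fun_mul hy)).fun_sub
    ((hy.fun_pow 3).const_mul (2 * a1 + a3))).congr_deriv ?_
  simp only [Pfun, Qfun, Ffun]
  push_cast
  ring

/-- The cube of the distance to the origin has cofactor `3 F`. -/
theorem hasDerivWithinAt_sqrt_cube {a1 a2 a3 t : ℝ} {I : Set ℝ} {x y : ℝ → ℝ}
    (hx : HasDerivWithinAt x (Pfun 0 0 a1 a2 a3 (x t) (y t)) I t)
    (hy : HasDerivWithinAt y (Qfun 0 0 a1 a2 a3 (x t) (y t)) I t)
    (hpos : 0 < x t ^ 2 + y t ^ 2) :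
    HasDerivWithinAt (fun s => Real.sqrt ((x s ^ 2 + y s ^ 2) ^ 3))
      (3 * Ffun 0 0 a1 a2 a3 (x t) (y t) * Real.sqrt ((x t ^ 2 + y t ^ 2) ^ 3)) I t := by
  have hcube : 0 < (x t ^ 2 + y t ^ 2) ^ 3 := by positivity
  convert (((hx.fun_pow 2).fun_add (hy.fun_pow 2)).fun_pow 3).sqrt hcube.ne' using 1
  have hsqrt : 0 < Real.sqrt ((x t ^ 2 + y t ^ 2) ^ 3) := Real.sqrt_pos.2 hcube
  rw [eq_div_iff (by positivity)]
  have hsq := Real.mul_self_sqrt hcube.le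
  simp only [Pfun, Qfun]
  push_cast
  linear_combination (6 * Ffun 0 0 a1 a2 a3 (x t) (y t)) * hsq

theorem first_integral_plane (b1 b2 a1 a2 a3 : ℝ)
    (hb1 : b1 = 0) (hb2 : b2 = 0)
    (I : Set ℝ) (hI : I.OrdConnected)
    (f : ℝ → ℝ × ℝ) (hf : IsSolutionOnE b1 b2 a1 a2 a3 f I)
    (hne : ∀ t ∈ I, f t ≠ (0, 0)) :
    ∀ t ∈ I, ∀ s ∈ I,
      Hfun a1 a2 a3 (f t).1 (f t).2 = Hfun a1 a2 a3 (f s).1 (f s).2 := by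
  subst hb1 hb2
  have hderiv : ∀ t ∈ I,
      HasDerivWithinAt (fun s => Hfun a1 a2 a3 (f s).1 (f s).2) 0 I t := by
    intro t ht
    have hx : HasDerivWithinAt (fun s => (f s).1)
        (Pfun 0 0 a1 a2 a3 (f t).1 (f t).2) I t :=
      (ContinuousLinearMap.fst ℝ ℝ ℝ).hasFDerivAt.comp_hasDerivWithinAt t (hf t ht)
    have hy : HasDerivWithinAt (fun s => (f s).2)
        (Qfun 0 0 a1 a2 a3 (f t).1 (f t).2) I t :=
      (ContinuousLinearMap.snd ℝ ℝ ℝ).hasFDerivAt.comp_hasDerivWithinAt t (hf t ht)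
    have hpos : 0 < (f t).1 ^ 2 + (f t).2 ^ 2 := by
      by_contra! h
      exact hne t ht (Prod.ext (by nlinarith [sq_nonneg (f t).1, sq_nonneg (f t).2])
        (by nlinarith [sq_nonneg (f t).1, sq_nonneg (f t).2]))
    have hsqrt : 0 < Real.sqrt (((f t).1 ^ 2 + (f t).2 ^ 2) ^ 3) :=
      Real.sqrt_pos.2 (by positivity)
    refine ((hasDerivWithinAt_numerator (x := fun s => (f s).1) (y := fun s => (f s).2)
      hx hy).fun_div ((hasDerivWithinAt_sqrt_cube (x := fun s => (f s).1)
      (y := fun s => (f s).2) hx hy hpos).const_mul 3) (by positivity)).congr_deriv ?_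
    rw [div_eq_iff (by positivity)]
    ring
  intro t ht s hs
  have h := hI.convex.norm_image_sub_le_of_norm_hasDerivWithin_le (C := 0) hderiv
    (fun _ _ => by simp) hs ht
  rw [zero_mul] at h
  exact sub_eq_zero.1 (norm_le_zero_iff.1 h)
end

section
/- There exist real parameters b1, b2, a1, a2, a3 such that the rigid system (E) has at least one limit cycle. -/
/-- `f : ℝ → ℝ × ℝ` is a (global) solution of the rigid system (E). -/
def IsSolutionE (b1 b2 a1 a2 a3 : ℝ) (f : ℝ → ℝ × ℝ) : Prop :=
  ∀ t : ℝ, HasDerivAt f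
    (Pfun b1 b2 a1 a2 a3 (f t).1 (f t).2, Qfun b1 b2 a1 a2 a3 (f t).1 (f t).2) t

/-- `f` is a non-constant periodic solution of the rigid system (E). -/
def IsPeriodicOrbitE (b1 b2 a1 a2 a3 : ℝ) (f : ℝ → ℝ × ℝ) : Prop :=
  IsSolutionE b1 b2 a1 a2 a3 f ∧ (∃ T > (0:ℝ), ∀ t, f (t + T) = f t) ∧
    (∃ t s : ℝ, f t ≠ f s)

/-- `f` is a limit cycle of the rigid system (E): a non-constant periodic solution
whose orbit has a neighborhood `U` such that the orbit of every non-constant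
periodic solution contained in `U` coincides with that of `f`. -/
def IsLimitCycleE (b1 b2 a1 a2 a3 : ℝ) (f : ℝ → ℝ × ℝ) : Prop :=
  IsPeriodicOrbitE b1 b2 a1 a2 a3 f ∧
    ∃ U : Set (ℝ × ℝ), IsOpen U ∧ Set.range f ⊆ U ∧
      ∀ g : ℝ → ℝ × ℝ, IsPeriodicOrbitE b1 b2 a1 a2 a3 g →
        Set.range g ⊆ U → Set.range g = Set.range f

open Real Set intervalIntegral

theorem integral_cos_pow_period (n : ℕ) :
    ∫ t in (0:ℝ)..2 * π, cos t ^ (n + 2) = (n + 1) / (n + 2) * ∫ t in (0:ℝ)..2 * π, cos t ^ n := by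
  rw [integral_cos_pow]; simp

theorem integral_cos_sq_period : ∫ t in (0:ℝ)..2 * π, cos t ^ 2 = π := by
  rw [integral_cos_pow_period 0]; simp

theorem integral_cos_four_period : ∫ t in (0:ℝ)..2 * π, cos t ^ 4 = 3 / 4 * π := by
  rw [integral_cos_pow_period 2, integral_cos_sq_period]; norm_num

theorem integral_cos_six_period : ∫ t in (0:ℝ)..2 * π, cos t ^ 6 = 5 / 8 * π := by
  rw [integral_cos_pow_period 4, integral_cos_four_period]; push_cast; ring

/-- Over a period, a function of `cos` may be replaced by twice its even part. -/
theorem two_mul_integral_comp_cos {h : ℝ → ℝ} (hc : Continuous fun t => h (cos t)) :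
    2 * ∫ t in (0:ℝ)..2 * π, h (cos t) =
      ∫ t in (0:ℝ)..2 * π, (h (cos t) + h (-cos t)) := by
  have hper : Function.Periodic (fun t => h (cos t)) (2 * π) := fun t => by simp
  have hneg : (fun t => h (-cos t)) = fun t => h (cos (t + π)) := by simp [cos_add_pi]
  have hc' : Continuous fun t => h (-cos t) := by
    rw [hneg]; exact hc.comp (continuous_add_const π)
  have hint : ∫ t in (0:ℝ)..2 * π, h (-cos t) = ∫ t in (0:ℝ)..2 * π, h (cos t) := by
    rw [hneg, integral_comp_add_right (fun t => h (cos t)) π, zero_add, add_comm,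
      hper.intervalIntegral_add_eq π 0, zero_add]
  rw [integral_add (hc.intervalIntegrable _ _) (hc'.intervalIntegrable _ _), hint, two_mul]

theorem three_sub_cos_ne (t : ℝ) : 3 - cos t ≠ 0 := by
  have := cos_le_one t; intro h; linarith

theorem cos_sq_mem_Icc (t : ℝ) : cos t ^ 2 ∈ Icc (0 : ℝ) 1 := ⟨sq_nonneg _, cos_sq_le_one t⟩

theorem continuous_cubic_div_pow (l : ℝ) (n : ℕ) :
    Continuous fun t => cos t * (cos t ^ 2 - l) / (3 - cos t) ^ n :=
  (by fun_prop : Continuous fun t => cos t * (cos t ^ 2 - l)).div₀ (by fun_prop)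
    fun t => pow_ne_zero _ (three_sub_cos_ne t)

theorem even_part_div_sq {c : ℝ} (hc : c ^ 2 ≤ 1) (l : ℝ) :
    c * (c ^ 2 - l) / (3 - c) ^ 2 + -c * ((-c) ^ 2 - l) / (3 - -c) ^ 2 =
      12 * (c ^ 2 * (c ^ 2 - l)) / (9 - c ^ 2) ^ 2 := by
  have h1 : 3 - c ≠ 0 := by intro h; nlinarith
  have h2 : 3 + c ≠ 0 := by intro h; nlinarith
  have h3 : 9 - c ^ 2 = (3 - c) * (3 + c) := by ring
  rw [h3, sub_neg_eq_add]
  field_simp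
  ring

theorem even_part_div_cube_sub {c : ℝ} (hc : c ^ 2 ≤ 1) {l : ℝ} (hl : l ≤ 1) :
    (c * (c ^ 2 - l) / (3 - c) ^ 3
        - (27 + l) / (6 * (9 - l)) * (c * (c ^ 2 - l) / (3 - c) ^ 2)) +
      (-c * ((-c) ^ 2 - l) / (3 - -c) ^ 3
        - (27 + l) / (6 * (9 - l)) * (-c * ((-c) ^ 2 - l) / (3 - -c) ^ 2)) =
      72 * (c ^ 2 * (c ^ 2 - l) ^ 2) / ((9 - c ^ 2) ^ 3 * (9 - l)) := by
  have h1 : 3 - c ≠ 0 := by intro h; nlinarith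
  have h2 : 3 + c ≠ 0 := by intro h; nlinarith
  have h4 : 9 - l ≠ 0 := by intro h; linarith
  have h3 : 9 - c ^ 2 = (3 - c) * (3 + c) := by ring
  rw [h3, sub_neg_eq_add]
  field_simp
  ring

theorem pi_div_le_integral_cube :
    π / 18 ≤ ∫ t in (0:ℝ)..2 * π, cos t * (cos t ^ 2 - 0) / (3 - cos t) ^ 2 := by
  have h := two_mul_integral_comp_cos (h := fun c => c * (c ^ 2 - 0) / (3 - c) ^ 2)
    (continuous_cubic_div_pow 0 2)
  have hle : ∫ t in (0:ℝ)..2 * π, 12 / 81 * cos t ^ 4 ≤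
      ∫ t in (0:ℝ)..2 * π, (cos t * (cos t ^ 2 - 0) / (3 - cos t) ^ 2 +
        -cos t * ((-cos t) ^ 2 - 0) / (3 - -cos t) ^ 2) := by
    have hc (t : ℝ) := even_part_div_sq (cos_sq_mem_Icc t).2 0
    simp only [hc]
    refine integral_mono_on (by positivity) (Continuous.intervalIntegrable (by fun_prop) _ _)
      (Continuous.intervalIntegrable ?_ _ _) fun t _ => ?_
    · refine Continuous.div₀ (by fun_prop) (by fun_prop) fun t => ?_
      have := cos_sq_mem_Icc t
      exact pow_ne_zero _ (by linarith [this.2])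
    · obtain ⟨h0, h1⟩ := cos_sq_mem_Icc t
      rw [le_div_iff₀ (by nlinarith)]
      have : (9 - cos t ^ 2) ^ 2 ≤ 81 := by nlinarith
      nlinarith [mul_le_mul_of_nonneg_left this (by positivity : 0 ≤ cos t ^ 4)]
  rw [integral_const_mul, integral_cos_four_period] at hle
  linarith

theorem integral_cube_sub_le :
    ∫ t in (0:ℝ)..2 * π, cos t * (cos t ^ 2 - 1) / (3 - cos t) ^ 2 ≤ -(π / 54) := by
  have h := two_mul_integral_comp_cos (h := fun c => c * (c ^ 2 - 1) / (3 - c) ^ 2)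
    (continuous_cubic_div_pow 1 2)
  have hle : ∫ t in (0:ℝ)..2 * π, (cos t * (cos t ^ 2 - 1) / (3 - cos t) ^ 2 +
        -cos t * ((-cos t) ^ 2 - 1) / (3 - -cos t) ^ 2) ≤
      ∫ t in (0:ℝ)..2 * π, 12 / 81 * (cos t ^ 4 - cos t ^ 2) := by
    have hc (t : ℝ) := even_part_div_sq (cos_sq_mem_Icc t).2 1
    simp only [hc]
    refine integral_mono_on (by positivity) (Continuous.intervalIntegrable ?_ _ _)
      (Continuous.intervalIntegrable (by fun_prop) _ _) fun t _ => ?_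
    · refine Continuous.div₀ (by fun_prop) (by fun_prop) fun t => ?_
      have := cos_sq_mem_Icc t
      exact pow_ne_zero _ (by linarith [this.2])
    · obtain ⟨h0, h1⟩ := cos_sq_mem_Icc t
      rw [div_le_iff₀ (by nlinarith)]
      have : (9 - cos t ^ 2) ^ 2 ≤ 81 := by nlinarith
      nlinarith [mul_le_mul_of_nonneg_left this
        (mul_nonneg h0 (sub_nonneg.2 h1))]
  rw [integral_const_mul, integral_sub (Continuous.intervalIntegrable (by fun_prop) _ _)
    (Continuous.intervalIntegrable (by fun_prop) _ _), integral_cos_four_period,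
    integral_cos_sq_period] at hle
  linarith

theorem pi_div_le_integral_div_cube_sub {l : ℝ} (hl : l ∈ Icc (0 : ℝ) 1) :
    π / 2916 ≤ (∫ t in (0:ℝ)..2 * π, cos t * (cos t ^ 2 - l) / (3 - cos t) ^ 3)
      - (27 + l) / (6 * (9 - l)) *
        ∫ t in (0:ℝ)..2 * π, cos t * (cos t ^ 2 - l) / (3 - cos t) ^ 2 := by
  have hc2 := continuous_cubic_div_pow l 2
  have hc3 := continuous_cubic_div_pow l 3
  rw [← integral_const_mul, ← integral_sub (hc3.intervalIntegrable _ _)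
    ((hc2.const_mul _).intervalIntegrable _ _)]
  have h := two_mul_integral_comp_cos (h := fun c => c * (c ^ 2 - l) / (3 - c) ^ 3
        - (27 + l) / (6 * (9 - l)) * (c * (c ^ 2 - l) / (3 - c) ^ 2))
    (hc3.sub (hc2.const_mul _))
  have hle : ∫ t in (0:ℝ)..2 * π, 72 / 9 ^ 4 *
        (cos t ^ 6 - (2 * l) * cos t ^ 4 + l ^ 2 * cos t ^ 2) ≤
      ∫ t in (0:ℝ)..2 * π, ((cos t * (cos t ^ 2 - l) / (3 - cos t) ^ 3
        - (27 + l) / (6 * (9 - l)) * (cos t * (cos t ^ 2 - l) / (3 - cos t) ^ 2)) +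
      (-cos t * ((-cos t) ^ 2 - l) / (3 - -cos t) ^ 3
        - (27 + l) / (6 * (9 - l)) * (-cos t * ((-cos t) ^ 2 - l) / (3 - -cos t) ^ 2))) := by
    have hc (t : ℝ) := even_part_div_cube_sub (cos_sq_mem_Icc t).2 hl.2
    simp only [hc]
    refine integral_mono_on (by positivity) (Continuous.intervalIntegrable (by fun_prop) _ _)
      (Continuous.intervalIntegrable ?_ _ _) fun t _ => ?_
    · refine Continuous.div₀ (by fun_prop) (by fun_prop) fun t => ?_
      have := cos_sq_mem_Icc t
      exact mul_ne_zero (pow_ne_zero _ (by linarith [this.2])) (by linarith [hl.2])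
    · obtain ⟨h0, h1⟩ := cos_sq_mem_Icc t
      have h9 : 0 < 9 - l := by linarith [hl.2]
      have h9' : 0 < 9 - cos t ^ 2 := by linarith
      rw [le_div_iff₀ (by positivity)]
      have hb : (9 - cos t ^ 2) ^ 3 * (9 - l) ≤ 9 ^ 3 * 9 :=
        mul_le_mul (pow_le_pow_left₀ h9'.le (by linarith) 3) (by linarith [hl.1]) h9.le
          (by positivity)
      calc 72 / 9 ^ 4 * (cos t ^ 6 - (2 * l) * cos t ^ 4 + l ^ 2 * cos t ^ 2) *
            ((9 - cos t ^ 2) ^ 3 * (9 - l))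
          = 72 / 9 ^ 4 * (cos t ^ 2 * (cos t ^ 2 - l) ^ 2) *
            ((9 - cos t ^ 2) ^ 3 * (9 - l)) := by ring
        _ ≤ 72 / 9 ^ 4 * (cos t ^ 2 * (cos t ^ 2 - l) ^ 2) * (9 ^ 3 * 9) := by gcongr
        _ = _ := by ring
  rw [integral_const_mul, integral_add (Continuous.intervalIntegrable (by fun_prop) _ _)
    (Continuous.intervalIntegrable (by fun_prop) _ _),
    integral_sub (Continuous.intervalIntegrable (by fun_prop) _ _)
    (Continuous.intervalIntegrable (by fun_prop) _ _), integral_const_mul, integral_const_mul,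
    integral_cos_four_period, integral_cos_six_period, integral_cos_sq_period] at hle
  nlinarith [mul_nonneg pi_pos.le (sq_nonneg (l - 3 / 4))]

theorem abs_cos_mul_le_one {l : ℝ} (hl : l ∈ Icc (0 : ℝ) 1) (t : ℝ) :
    |cos t * (cos t ^ 2 - l)| ≤ 1 := by
  obtain ⟨h0, h1⟩ := cos_sq_mem_Icc t
  rw [abs_mul]
  exact mul_le_one₀ (abs_cos_le_one t) (abs_nonneg _)
    (abs_le.2 ⟨by linarith [hl.2], by linarith [hl.1]⟩)

theorem abs_inv_sub_inv_le {u v : ℝ} (hu : 1 ≤ u) (hv : 1 ≤ v) : |u⁻¹ - v⁻¹| ≤ |u - v| := by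
  rw [inv_sub_inv (by positivity) (by positivity), abs_div, abs_sub_comm v u]
  refine div_le_self (abs_nonneg _) ?_
  rw [abs_of_pos (by positivity)]
  exact one_le_mul_of_one_le_of_one_le hu hv

theorem abs_mul_sub_mul_le {p q r s : ℝ} (hp : |p| ≤ 1) (hs : |s| ≤ 1) :
    |p * q - r * s| ≤ |p - r| + |q - s| := by
  have h : p * q - r * s = (p - r) * s + p * (q - s) := by ring
  rw [h]
  refine (abs_add_le _ _).trans ?_
  rw [abs_mul, abs_mul]
  exact add_le_add (mul_le_of_le_one_right (abs_nonneg _) hs)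
    (mul_le_of_le_one_left (abs_nonneg _) hp)

theorem abs_inv_le_one {u : ℝ} (hu : 1 ≤ u) : |u⁻¹| ≤ 1 := by
  rw [abs_of_pos (by positivity)]; exact inv_le_one_of_one_le₀ hu

theorem abs_inv_sq_sub_inv_sq_le {u v : ℝ} (hu : 1 ≤ u) (hv : 1 ≤ v) :
    |(u ^ 2)⁻¹ - (v ^ 2)⁻¹| ≤ 2 * |u - v| := by
  have := abs_mul_sub_mul_le (q := u⁻¹) (r := v⁻¹) (abs_inv_le_one hu) (abs_inv_le_one hv)
  rw [sq, sq, mul_inv, mul_inv]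
  linarith [abs_inv_sub_inv_le hu hv]

theorem abs_inv_mul_sub_inv_cube_le {x y v d : ℝ} (hx : 1 ≤ x) (hy : 1 ≤ y) (hv : 1 ≤ v)
    (hxd : |x - v| ≤ d) (hyd : |y - v| ≤ d) :
    |(x * y ^ 2)⁻¹ - (v ^ 3)⁻¹| ≤ 3 * d := by
  have h1 := abs_mul_sub_mul_le (q := (y ^ 2)⁻¹) (r := v⁻¹) (s := (v ^ 2)⁻¹) (abs_inv_le_one hx)
    (abs_inv_le_one (one_le_pow₀ hv))
  rw [mul_inv, show v ^ 3 = v * v ^ 2 by ring, mul_inv v]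
  linarith [abs_inv_sub_inv_le hx hv, abs_inv_sq_sub_inv_sq_le hy hv]

theorem abs_integral_sub_unperturbed_le {l d : ℝ} (hl : l ∈ Icc (0 : ℝ) 1) (hd : d ≤ 1)
    {w : ℝ → ℝ} (hw : ContinuousOn w (Icc 0 (2 * π)))
    (hwd : ∀ t ∈ Icc 0 (2 * π), |w t - 3| ≤ d) :
    |(∫ t in (0:ℝ)..2 * π, cos t * (cos t ^ 2 - l) / (w t - cos t) ^ 2) -
      ∫ t in (0:ℝ)..2 * π, cos t * (cos t ^ 2 - l) / (3 - cos t) ^ 2| ≤ 4 * π * d := by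
  have h1 (t) (ht : t ∈ Icc 0 (2 * π)) : 1 ≤ w t - cos t := by
    have := abs_le.1 (hwd t ht)
    linarith [cos_le_one t]
  have hint : IntervalIntegrable (fun t => cos t * (cos t ^ 2 - l) / (w t - cos t) ^ 2)
      MeasureTheory.volume 0 (2 * π) := by
    apply ContinuousOn.intervalIntegrable
    rw [uIcc_of_le (by positivity)]
    exact ContinuousOn.div₀ (by fun_prop) (by fun_prop)
      fun t ht => pow_ne_zero _ (by linarith [h1 t ht])
  rw [← integral_sub hint ((continuous_cubic_div_pow l 2).intervalIntegrable _ _)]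
  rw [← Real.norm_eq_abs]
  refine (norm_integral_le_of_norm_le_const (C := 2 * d) fun t ht => ?_).trans ?_
  · rw [uIoc_of_le (by positivity)] at ht
    have ht' := Ioc_subset_Icc_self ht
    rw [Real.norm_eq_abs, div_eq_mul_inv, div_eq_mul_inv, ← mul_sub, abs_mul]
    refine (mul_le_of_le_one_left (abs_nonneg _) (abs_cos_mul_le_one hl t)).trans ?_
    refine (abs_inv_sq_sub_inv_sq_le (h1 t ht') (by linarith [cos_le_one t])).trans ?_
    rw [sub_sub_sub_cancel_right]
    linarith [hwd t ht']
  · rw [sub_zero, abs_of_pos (by positivity)]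
    linarith

/-- The size of the perturbation. -/
noncomputable def eps : ℝ := 1 / 10 ^ 6

/-- The equation satisfied by `1 / r + cos θ` along the orbits, with the denominator truncated
so as to make it globally Lipschitz; the second component carries the parameter. -/
noncomputable def truncField (t : ℝ) (p : ℝ × ℝ) : ℝ × ℝ :=
  (-eps * (cos t * (cos t ^ 2 - p.2)) * (max 1 (p.1 - cos t) ^ 2)⁻¹, 0)

theorem abs_truncField_fst_le {t : ℝ} {p : ℝ × ℝ} {b : ℝ} (hb : |cos t * (cos t ^ 2 - p.2)| ≤ b) :
    |(truncField t p).1| ≤ eps * b := by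
  have h1 : |(max 1 (p.1 - cos t) ^ 2)⁻¹| ≤ 1 := abs_inv_le_one (one_le_pow₀ (le_max_left _ _))
  have he : 0 < eps := by norm_num [eps]
  rw [truncField, abs_mul, abs_mul, abs_neg, abs_of_pos he]
  have hb0 : 0 ≤ b := (abs_nonneg _).trans hb
  calc _ ≤ eps * b * 1 := by gcongr
    _ = _ := mul_one _

theorem abs_cos_mul_le_two {t m : ℝ} (hm : |m - 1 / 2| ≤ 1) :
    |cos t * (cos t ^ 2 - m)| ≤ 2 := by
  obtain ⟨h0, h1⟩ := cos_sq_mem_Icc t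
  obtain ⟨h2, h3⟩ := abs_le.1 hm
  rw [abs_mul]
  have : |cos t ^ 2 - m| ≤ 2 := abs_le.2 ⟨by linarith, by linarith⟩
  nlinarith [abs_cos_le_one t, abs_nonneg (cos t), abs_nonneg (cos t ^ 2 - m)]

theorem mem_closedBall_center {p : ℝ × ℝ} {a : ℝ} :
    p ∈ Metric.closedBall ((3, 1 / 2) : ℝ × ℝ) a ↔ |p.1 - 3| ≤ a ∧ |p.2 - 1 / 2| ≤ a := by
  rw [Metric.mem_closedBall, Prod.dist_eq, max_le_iff, Real.dist_eq, Real.dist_eq]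

theorem isPicardLindelof_truncField :
    IsPicardLindelof truncField (tmin := 0) (tmax := 2 * π) ⟨0, ⟨le_rfl, by positivity⟩⟩
      ((3, 1 / 2) : ℝ × ℝ) 1 (1 / 2) (1 / 50) 5 where
  lipschitzOnWith t _ := by
    refine LipschitzOnWith.of_dist_le_mul fun p hp q hq => ?_
    obtain ⟨-, hp⟩ := mem_closedBall_center.1 hp
    rw [Prod.dist_eq, Prod.dist_eq]
    simp only [truncField, dist_self, Real.dist_eq, NNReal.coe_ofNat]
    rw [max_eq_left (abs_nonneg _)]
    have hb := abs_cos_mul_le_two (t := t) hp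
    set u := max 1 (p.1 - cos t)
    set v := max 1 (q.1 - cos t)
    have hu : 1 ≤ u := le_max_left _ _
    have hv : 1 ≤ v := le_max_left _ _
    have huv : |u - v| ≤ |p.1 - q.1| := by
      have := abs_max_sub_max_le_abs (p.1 - cos t) (q.1 - cos t) 1
      rw [max_comm _ 1, max_comm _ 1] at this
      simpa using this
    have h1 := abs_inv_sq_sub_inv_sq_le hu hv
    have h2 : |(v ^ 2)⁻¹| ≤ 1 := abs_inv_le_one (one_le_pow₀ hv)
    have h3 : -eps * (cos t * (cos t ^ 2 - p.2)) * (u ^ 2)⁻¹ -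
        -eps * (cos t * (cos t ^ 2 - q.2)) * (v ^ 2)⁻¹ =
        -eps * ((cos t * (cos t ^ 2 - p.2)) * ((u ^ 2)⁻¹ - (v ^ 2)⁻¹) +
          -(cos t) * (p.2 - q.2) * (v ^ 2)⁻¹) := by ring
    rw [h3, abs_mul, abs_neg]
    have he : |eps| ≤ 1 := by norm_num [eps, abs_le]
    refine (mul_le_of_le_one_left (abs_nonneg _) he).trans ((abs_add_le _ _).trans ?_)
    have h4 : |cos t * (cos t ^ 2 - p.2) * ((u ^ 2)⁻¹ - (v ^ 2)⁻¹)| ≤ 2 * (2 * |p.1 - q.1|) := by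
      rw [abs_mul]; gcongr; linarith
    have h5 : |-(cos t) * (p.2 - q.2) * (v ^ 2)⁻¹| ≤ |p.2 - q.2| := by
      rw [abs_mul, abs_mul, abs_neg]
      exact (mul_le_of_le_one_right (by positivity) h2).trans
        (mul_le_of_le_one_left (abs_nonneg _) (abs_cos_le_one t))
    linarith [le_max_left |p.1 - q.1| |p.2 - q.2|, le_max_right |p.1 - q.1| |p.2 - q.2|]
  continuousOn p _ := by
    refine Continuous.continuousOn (Continuous.prodMk (Continuous.mul (by fun_prop)
      (Continuous.inv₀ (by fun_prop) fun t => ?_)) continuous_const)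
    have : 1 ≤ max 1 (p.1 - cos t) := le_max_left _ _
    positivity
  norm_le t _ p hp := by
    obtain ⟨-, hp⟩ := mem_closedBall_center.1 hp
    have := abs_truncField_fst_le (abs_cos_mul_le_two (t := t) hp)
    rw [Prod.norm_def, max_le_iff]
    refine ⟨this.trans (by norm_num [eps]), by simp [truncField]⟩
  mul_max_le := by
    have : max (2 * π - 0) ((0 : ℝ) - 0) = 2 * π := by
      rw [sub_zero, sub_zero]; exact max_eq_left (by positivity)
    simp only [this]
    push_cast
    linarith [pi_lt_d2]

theorem abs_sub_le_of_bounded_deriv {w w' : ℝ → ℝ} {a b C : ℝ}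
    (hw : ∀ t ∈ Icc a b, HasDerivWithinAt w (w' t) (Icc a b) t)
    (hC : ∀ t ∈ Icc a b, |w' t| ≤ C) {t : ℝ} (ht : t ∈ Icc a b) : |w t - w a| ≤ C * (t - a) :=
  norm_image_sub_le_of_norm_deriv_le_segment' hw (fun t ht => hC t (Ico_subset_Icc_self ht)) t ht

theorem exists_flow : ∃ w : ℝ → ℝ → ℝ,
    ContinuousOn (fun l => w l (2 * π)) (Icc 0 1) ∧ ∀ l ∈ Icc (0 : ℝ) 1, w l 0 = 3 ∧
      (∀ t ∈ Icc 0 (2 * π), |w l t - 3| ≤ 9 / 10 ^ 6) ∧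
      ∀ t ∈ Icc 0 (2 * π), HasDerivWithinAt (w l)
        (-eps * (cos t * (cos t ^ 2 - l) / (w l t - cos t) ^ 2)) (Icc 0 (2 * π)) t := by
  obtain ⟨α, hα, K, hK⟩ := isPicardLindelof_truncField
    |>.exists_forall_mem_closedBall_eq_hasDerivWithinAt_lipschitzOnWith
  have hmem (l : ℝ) (hl : l ∈ Icc (0 : ℝ) 1) :
      ((3, l) : ℝ × ℝ) ∈ Metric.closedBall ((3, 1 / 2) : ℝ × ℝ) ((1 / 2 : NNReal) : ℝ) := by
    rw [mem_closedBall_center]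
    push_cast
    exact ⟨by norm_num, abs_le.2 ⟨by linarith [hl.1], by linarith [hl.2]⟩⟩
  have hpi : (2 * π) ∈ Icc 0 (2 * π) := ⟨by positivity, le_rfl⟩
  refine ⟨fun l t => (α (3, l) t).1, ?_, fun l hl => ?_⟩
  · exact continuous_fst.comp_continuousOn
      (((hK _ hpi).continuousOn).comp (by fun_prop) fun l hl => hmem l hl)
  obtain ⟨h0, hd⟩ := hα _ (hmem l hl)
  have hd1 (t) (ht : t ∈ Icc 0 (2 * π)) : HasDerivWithinAt (fun s => (α (3, l) s).1)
      (truncField t (α (3, l) t)).1 (Icc 0 (2 * π)) t :=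
    (ContinuousLinearMap.fst ℝ ℝ ℝ).hasFDerivAt.comp_hasDerivWithinAt t (hd t ht)
  have hd2 (t) (ht : t ∈ Icc 0 (2 * π)) : HasDerivWithinAt (fun s => (α (3, l) s).2)
      (truncField t (α (3, l) t)).2 (Icc 0 (2 * π)) t :=
    (ContinuousLinearMap.snd ℝ ℝ ℝ).hasFDerivAt.comp_hasDerivWithinAt t (hd t ht)
  simp only at h0
  have hl2 (t) (ht : t ∈ Icc 0 (2 * π)) : (α (3, l) t).2 = l := by
    have := abs_sub_le_of_bounded_deriv (C := 0) hd2 (fun t _ => by simp [truncField]) ht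
    rw [zero_mul, h0] at this
    linarith [abs_nonpos_iff.1 this]
  have hb (t) (ht : t ∈ Icc 0 (2 * π)) : |(α (3, l) t).1 - 3| ≤ 9 / 10 ^ 6 := by
    have := abs_sub_le_of_bounded_deriv (C := eps * 1) hd1 (fun t ht => abs_truncField_fst_le
      (by rw [hl2 t ht]; exact abs_cos_mul_le_one hl t)) ht
    rw [h0] at this
    refine this.trans ?_
    have := ht.2
    norm_num [eps]
    linarith [pi_lt_d2]
  refine ⟨congrArg Prod.fst h0, hb, fun t ht => ?_⟩
  have h1 : 1 ≤ (α (3, l) t).1 - cos t := by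
    have := abs_le.1 (hb t ht)
    linarith [cos_le_one t]
  convert! hd1 t ht using 1
  simp only [truncField, max_eq_right h1, hl2 t ht]
  ring

theorem exists_periodic_extension {T : ℝ} (hT : 0 < T) {w : ℝ → ℝ} (hw : w T = w 0) :
    ∃ W : ℝ → ℝ, Function.Periodic W T ∧ ∀ (n : ℤ), ∀ t ∈ Icc 0 T, W (t + n * T) = w t := by
  refine ⟨fun t => w (toIcoMod hT 0 t), fun t => by simp, fun n t ht => ?_⟩
  have h : toIcoMod hT 0 (t + n * T) = toIcoMod hT 0 t := by
    rw [← zsmul_eq_mul]; exact toIcoMod_add_zsmul hT 0 t n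
  simp only [h]
  rcases ht.2.lt_or_eq with hlt | rfl
  · rw [(toIcoMod_eq_self hT).2 ⟨ht.1, by simpa using hlt⟩]
  · have := toIcoMod_apply_right hT 0
    rw [zero_add] at this
    rw [this, hw]

theorem exists_periodic_solution_of_Icc {T : ℝ} (hT : 0 < T) {w : ℝ → ℝ} {v : ℝ → ℝ → ℝ}
    (hw : w T = w 0) (hv : ∀ x, Function.Periodic (v · x) T)
    (hd : ∀ t ∈ Icc 0 T, HasDerivWithinAt w (v t (w t)) (Icc 0 T) t) :
    ∃ W : ℝ → ℝ, Function.Periodic W T ∧ (∀ t, ∃ s ∈ Icc 0 T, W t = w s) ∧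
      ∀ t, HasDerivAt W (v t (W t)) t := by
  obtain ⟨W, hper, hW⟩ := exists_periodic_extension hT hw
  have hloc (n : ℤ) (t : ℝ) (ht : t ∈ Icc (n * T) (n * T + T)) :
      HasDerivWithinAt W (v t (W t)) (Icc (n * T) (n * T + T)) t := by
    have hmaps : MapsTo (fun s => s - n * T) (Icc (n * T) (n * T + T)) (Icc 0 T) :=
      fun s hs => ⟨by linarith [hs.1], by linarith [hs.2]⟩
    have hWs (s) (hs : s ∈ Icc (n * T) (n * T + T)) : W s = w (s - n * T) := by
      rw [← hW n _ (hmaps hs), sub_add_cancel]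
    have hvt : v t (W t) = v (t - n * T) (w (t - n * T)) := by
      rw [hWs t ht]; exact ((hv _).sub_int_mul_eq n).symm
    rw [hvt]
    have := (hd _ (hmaps ht)).comp t ((hasDerivAt_id t).sub_const (n * T)).hasDerivWithinAt hmaps
    rw [mul_one] at this
    exact this.congr hWs (hWs t ht)
  have hfloor (t : ℝ) : ⌊t / T⌋ * T ≤ t ∧ t < ⌊t / T⌋ * T + T := by
    have h1 := Int.floor_le (t / T)
    have h2 := Int.lt_floor_add_one (t / T)
    rw [le_div_iff₀ hT] at h1
    rw [div_lt_iff₀ hT] at h2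
    exact ⟨h1, by linarith⟩
  refine ⟨W, hper, fun t => ?_, fun t => ?_⟩
  · obtain ⟨h1, h2⟩ := hfloor t
    refine ⟨t - ⌊t / T⌋ * T, ⟨by linarith, by linarith⟩, ?_⟩
    rw [← hW ⌊t / T⌋ _ ⟨by linarith, by linarith⟩, sub_add_cancel]
  · obtain ⟨h1, h2⟩ := hfloor t
    set n := ⌊t / T⌋
    have hr := hloc n t ⟨h1, h2.le⟩
    rcases h1.lt_or_eq with h1 | h1
    · exact hr.hasDerivAt (Icc_mem_nhds h1 h2)
    · have hn : ((n - 1 : ℤ) : ℝ) * T + T = t := by push_cast; linarith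
      have hl := hloc (n - 1) t ⟨by linarith, hn.ge⟩
      rw [hn] at hl
      rw [h1] at hr
      refine (hl.union hr).hasDerivAt ?_
      rw [Icc_union_Icc_eq_Icc (by linarith) (by linarith)]
      exact Icc_mem_nhds (by linarith) (by linarith)

theorem one_le_sub_cos {x : ℝ} (hx : |x - 3| ≤ 1) (t : ℝ) : 1 ≤ x - cos t := by
  linarith [cos_le_one t, (abs_le.1 hx).1]

theorem sub_eq_neg_eps_mul_integral {l : ℝ} {w : ℝ → ℝ} (hb : ∀ t ∈ Icc 0 (2 * π), |w t - 3| ≤ 1)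
    (hd : ∀ t ∈ Icc 0 (2 * π), HasDerivWithinAt w
        (-eps * (cos t * (cos t ^ 2 - l) / (w t - cos t) ^ 2)) (Icc 0 (2 * π)) t) :
    w (2 * π) - w 0 =
      -eps * ∫ t in (0:ℝ)..2 * π, cos t * (cos t ^ 2 - l) / (w t - cos t) ^ 2 := by
  have hw : ContinuousOn w (Icc 0 (2 * π)) := fun t ht => (hd t ht).continuousWithinAt
  rw [← integral_const_mul]
  refine (integral_eq_sub_of_hasDerivAt_of_le (by positivity) hw (fun t ht =>
    (hd t (Ioo_subset_Icc_self ht)).hasDerivAt (Icc_mem_nhds ht.1 ht.2)) ?_).symm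
  apply ContinuousOn.intervalIntegrable
  rw [uIcc_of_le (by positivity)]
  exact continuousOn_const.mul (ContinuousOn.div₀ (by fun_prop) (by fun_prop)
    fun t ht => pow_ne_zero _ ((zero_lt_one.trans_le (one_le_sub_cos (hb t ht) t)).ne'))

theorem exists_periodic_branch : ∃ l ∈ Icc (0 : ℝ) 1, ∃ w : ℝ → ℝ, Function.Periodic w (2 * π) ∧
    (∀ t, |w t - 3| ≤ 9 / 10 ^ 6) ∧
    ∀ t, HasDerivAt w (-eps * (cos t * (cos t ^ 2 - l) / (w t - cos t) ^ 2)) t := by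
  obtain ⟨w, hcont, hw⟩ := exists_flow
  have he : 0 < eps := by norm_num [eps]
  have hpi := pi_pos
  have hend (l : ℝ) (hl : l ∈ Icc (0 : ℝ) 1) := by
    obtain ⟨h0, hb, hd⟩ := hw l hl
    have h1 := sub_eq_neg_eps_mul_integral (fun t ht => (hb t ht).trans (by norm_num)) hd
    have h2 := abs_integral_sub_unperturbed_le hl (by norm_num)
      (fun t ht => (hd t ht).continuousWithinAt) hb
    exact And.intro (h0 ▸ h1) (abs_le.1 h2)
  have hzero : w 0 (2 * π) ≤ 3 := by
    obtain ⟨h1, h2, -⟩ := hend 0 (by simp)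
    have h3 := pi_div_le_integral_cube
    nlinarith
  have hone : 3 ≤ w 1 (2 * π) := by
    obtain ⟨h1, -, h2⟩ := hend 1 (by simp)
    have h3 := integral_cube_sub_le
    nlinarith
  obtain ⟨l, hl, hl3⟩ := intermediate_value_Icc zero_le_one hcont ⟨hzero, hone⟩
  obtain ⟨h0, hb, hd⟩ := hw l hl
  obtain ⟨W, hper, hval, hW⟩ := exists_periodic_solution_of_Icc (T := 2 * π) (by positivity)
    (v := fun t x => -eps * (cos t * (cos t ^ 2 - l) / (x - cos t) ^ 2))
    (by rw [h0]; exact hl3) (fun x t => by simp) hd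
  refine ⟨l, hl, W, hper, fun t => ?_, hW⟩
  obtain ⟨s, hs, hst⟩ := hval t
  rw [hst]
  exact hb s hs

theorem integral_div_cube_ge {l : ℝ} (hl : l ∈ Icc (0 : ℝ) 1) {w : ℝ → ℝ}
    (hper : Function.Periodic w (2 * π)) (hb : ∀ t, |w t - 3| ≤ 9 / 10 ^ 6)
    (hd : ∀ t, HasDerivAt w (-eps * (cos t * (cos t ^ 2 - l) / (w t - cos t) ^ 2)) t) :
    3 / 10 ^ 4 * π ≤ ∫ t in (0:ℝ)..2 * π, cos t * (cos t ^ 2 - l) / (3 - cos t) ^ 3 := by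
  have h1 := sub_eq_neg_eps_mul_integral (fun t _ => (hb t).trans (by norm_num))
    (fun t _ => (hd t).hasDerivWithinAt)
  have h2 := abs_integral_sub_unperturbed_le hl (by norm_num)
    (fun t _ => (hd t).continuousAt.continuousWithinAt) (fun t _ => hb t)
  have he : -eps ≠ 0 := by norm_num [eps]
  rw [← zero_add (2 * π), hper 0, zero_add, sub_self, eq_comm, mul_eq_zero, or_iff_right he] at h1
  rw [h1, zero_sub, abs_neg] at h2
  have h3 := pi_div_le_integral_div_cube_sub hl
  have hk : |(27 + l) / (6 * (9 - l))| ≤ 1 := by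
    have h4 : 0 < 6 * (9 - l) := by linarith [hl.2]
    rw [abs_of_nonneg (div_nonneg (by linarith [hl.1]) h4.le), div_le_one h4]
    linarith [hl.2]
  have h5 := (abs_mul _ _).trans_le ((mul_le_of_le_one_left (abs_nonneg _) hk).trans h2)
  linarith [(abs_le.1 h5).1, pi_pos]

theorem integral_linearization_pos {l : ℝ} (hl : l ∈ Icc (0 : ℝ) 1)
    (hJ : 3 / 10 ^ 4 * π ≤ ∫ t in (0:ℝ)..2 * π, cos t * (cos t ^ 2 - l) / (3 - cos t) ^ 3)
    {u v : ℝ → ℝ} (hu : Continuous u) (hv : Continuous v)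
    (hub : ∀ t, |u t - 3| ≤ 1 / 10 ^ 5) (hvb : ∀ t, |v t - 3| ≤ 1 / 10 ^ 5)
    {n : ℤ} (hn : 0 < n) :
    0 < ∫ t in (0:ℝ)..n * (2 * π), cos t * (cos t ^ 2 - l) *
      (((u t - cos t) * (v t - cos t) ^ 2)⁻¹ + ((v t - cos t) * (u t - cos t) ^ 2)⁻¹) := by
  have hn' : (0 : ℝ) < n := by exact_mod_cast hn
  have hpi := pi_pos
  have hu1 (t) : 1 ≤ u t - cos t := one_le_sub_cos ((hub t).trans (by norm_num)) t
  have hv1 (t) : 1 ≤ v t - cos t := one_le_sub_cos ((hvb t).trans (by norm_num)) t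
  have hc3 := continuous_cubic_div_pow l 3
  have hper : Function.Periodic (fun t => cos t * (cos t ^ 2 - l) / (3 - cos t) ^ 3) (2 * π) :=
    fun t => by simp
  have h1 := hper.intervalIntegral_add_zsmul_eq n 0 fun _ _ => hc3.intervalIntegrable _ _
  rw [zero_add, zero_add, zsmul_eq_mul, zsmul_eq_mul] at h1
  have hle : ∫ t in (0:ℝ)..n * (2 * π),
      (2 * (cos t * (cos t ^ 2 - l) / (3 - cos t) ^ 3) - 6 / 10 ^ 5) ≤
      ∫ t in (0:ℝ)..n * (2 * π), cos t * (cos t ^ 2 - l) *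
      (((u t - cos t) * (v t - cos t) ^ 2)⁻¹ + ((v t - cos t) * (u t - cos t) ^ 2)⁻¹) := by
    refine integral_mono_on (by positivity)
      (((hc3.const_mul 2).sub continuous_const).intervalIntegrable _ _)
      (Continuous.intervalIntegrable ?_ _ _) fun t _ => ?_
    · refine Continuous.mul (by fun_prop) ((Continuous.inv₀ (by fun_prop) fun t => ?_).add
        (Continuous.inv₀ (by fun_prop) fun t => ?_))
      all_goals
        have := hu1 t
        have := hv1 t
        positivity
    · have hcos := cos_le_one t
      have h2 := abs_inv_mul_sub_inv_cube_le (d := 1 / 10 ^ 5) (v := 3 - cos t) (hu1 t) (hv1 t)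
        (by linarith) (by simpa using hub t) (by simpa using hvb t)
      have h3 := abs_inv_mul_sub_inv_cube_le (d := 1 / 10 ^ 5) (v := 3 - cos t) (hv1 t) (hu1 t)
        (by linarith) (by simpa using hvb t) (by simpa using hub t)
      have hB := abs_cos_mul_le_one hl t
      have h4 (y : ℝ) : |cos t * (cos t ^ 2 - l) * y| ≤ |y| := by
        rw [abs_mul]; exact mul_le_of_le_one_left (abs_nonneg _) hB
      have h5 := (abs_le.1 ((h4 _).trans h2)).1
      have h6 := (abs_le.1 ((h4 _).trans h3)).1
      rw [div_eq_mul_inv]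
      linarith
  rw [integral_sub ((hc3.const_mul 2).intervalIntegrable _ _) intervalIntegrable_const,
    integral_const_mul, h1, integral_const, smul_eq_mul, sub_zero] at hle
  have h7 := mul_le_mul_of_nonneg_left hJ hn'.le
  have h8 := mul_pos hn' hpi
  linarith

/-- A solution of a scalar linear equation which takes equal values at two points between which the
coefficient has nonzero integral vanishes identically. -/
theorem eq_zero_of_linear_ode {d g : ℝ → ℝ} (hg : Continuous g)
    (hd : ∀ t, HasDerivAt d (g t * d t) t) {T : ℝ} (hT : d T = d 0)
    (hne : ∫ t in (0:ℝ)..T, g t ≠ 0) (t : ℝ) : d t = 0 := by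
  have hG (t : ℝ) : HasDerivAt (fun s => d s * exp (-∫ r in (0:ℝ)..s, g r)) 0 t := by
    convert! (hd t).mul (hg.integral_hasStrictDerivAt 0 t).hasDerivAt.neg.exp using 1
    ring
  have hconst := is_const_of_deriv_eq_zero (fun t => (hG t).differentiableAt)
    (fun t => (hG t).deriv)
  have h0 : d 0 = 0 := by
    have := hconst T 0
    rw [hT, integral_same, neg_zero, exp_zero] at this
    by_contra h
    have h1 := mul_left_cancel₀ h this
    rw [exp_eq_one_iff, neg_eq_zero] at h1
    exact hne h1
  have := hconst t 0
  rw [h0, zero_mul] at this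
  exact (mul_eq_zero.1 this).resolve_right (exp_ne_zero _)

theorem branch_unique {l : ℝ} (hl : l ∈ Icc (0 : ℝ) 1)
    (hJ : 3 / 10 ^ 4 * π ≤ ∫ t in (0:ℝ)..2 * π, cos t * (cos t ^ 2 - l) / (3 - cos t) ^ 3)
    {u v : ℝ → ℝ} (hub : ∀ t, |u t - 3| ≤ 1 / 10 ^ 5) (hvb : ∀ t, |v t - 3| ≤ 1 / 10 ^ 5)
    (hud : ∀ t, HasDerivAt u (-eps * (cos t * (cos t ^ 2 - l) / (u t - cos t) ^ 2)) t)
    (hvd : ∀ t, HasDerivAt v (-eps * (cos t * (cos t ^ 2 - l) / (v t - cos t) ^ 2)) t)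
    {n : ℤ} (hn : 0 < n) (hu : u (n * (2 * π)) = u 0) (hv : v (n * (2 * π)) = v 0) : u = v := by
  have huc : Continuous u := continuous_iff_continuousAt.2 fun t => (hud t).continuousAt
  have hvc : Continuous v := continuous_iff_continuousAt.2 fun t => (hvd t).continuousAt
  have hu1 (t) : 1 ≤ u t - cos t := one_le_sub_cos ((hub t).trans (by norm_num)) t
  have hv1 (t) : 1 ≤ v t - cos t := one_le_sub_cos ((hvb t).trans (by norm_num)) t
  have hpos := integral_linearization_pos hl hJ huc hvc hub hvb hn
  have he : eps ≠ 0 := by norm_num [eps]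
  ext t
  refine sub_eq_zero.1 (eq_zero_of_linear_ode (d := fun t => u t - v t)
    (g := fun t => eps * (cos t * (cos t ^ 2 - l) *
      (((u t - cos t) * (v t - cos t) ^ 2)⁻¹ + ((v t - cos t) * (u t - cos t) ^ 2)⁻¹)))
    (T := n * (2 * π)) ?_ (fun s => ?_) (by rw [hu, hv]) ?_ t)
  · refine Continuous.mul continuous_const (Continuous.mul (by fun_prop)
      ((Continuous.inv₀ (by fun_prop) fun t => ?_).add
        (Continuous.inv₀ (by fun_prop) fun t => ?_)))
    all_goals
      have := hu1 t
      have := hv1 t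
      positivity
  · convert! (hud s).sub (hvd s) using 1
    have h1 : u s - cos s ≠ 0 := (zero_lt_one.trans_le (hu1 s)).ne'
    have h2 : v s - cos s ≠ 0 := (zero_lt_one.trans_le (hv1 s)).ne'
    field_simp
    ring
  · rw [integral_const_mul]
    exact mul_ne_zero he hpos.ne'

theorem Ffun_polar {c s : ℝ} (h : c ^ 2 + s ^ 2 = 1) (l r : ℝ) :
    Ffun 0 (-1) (eps * (1 - l)) 0 (-(eps * l)) (r * c) (r * s) =
      -(r * s) + eps * r ^ 3 * (c * (c ^ 2 - l)) := by
  have hs : s ^ 2 = 1 - c ^ 2 := by linarith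
  rw [Ffun]
  linear_combination -(eps * l * r ^ 3 * c) * hs

/-- The curve with polar equation `r = 1 / (w θ - cos θ)`. -/
noncomputable def polarCurve (w : ℝ → ℝ) (t : ℝ) : ℝ × ℝ :=
  ((w t - cos t)⁻¹ * cos t, (w t - cos t)⁻¹ * sin t)

theorem isSolutionE_polarCurve {l : ℝ} {w : ℝ → ℝ} (hw : ∀ t, 1 ≤ w t - cos t)
    (hd : ∀ t, HasDerivAt w (-eps * (cos t * (cos t ^ 2 - l) / (w t - cos t) ^ 2)) t) :
    IsSolutionE 0 (-1) (eps * (1 - l)) 0 (-(eps * l)) (polarCurve w) := by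
  intro t
  have hu : w t - cos t ≠ 0 := (zero_lt_one.trans_le (hw t)).ne'
  have hr := ((hd t).sub (hasDerivAt_cos t)).inv hu
  have hF := Ffun_polar (cos_sq_add_sin_sq t) l (w t - cos t)⁻¹
  refine HasDerivAt.prodMk ?_ ?_
  · convert! hr.mul (hasDerivAt_cos t) using 1
    simp only [Pfun, polarCurve, hF, Pi.sub_apply, Pi.inv_apply]
    field_simp
    ring
  · convert! hr.mul (hasDerivAt_sin t) using 1
    simp only [Qfun, polarCurve, hF, Pi.sub_apply, Pi.inv_apply]
    field_simp
    ring

theorem isPeriodicOrbitE_polarCurve {l : ℝ} {w : ℝ → ℝ} (hw : ∀ t, 1 ≤ w t - cos t)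
    (hper : Function.Periodic w (2 * π))
    (hd : ∀ t, HasDerivAt w (-eps * (cos t * (cos t ^ 2 - l) / (w t - cos t) ^ 2)) t) :
    IsPeriodicOrbitE 0 (-1) (eps * (1 - l)) 0 (-(eps * l)) (polarCurve w) := by
  refine ⟨isSolutionE_polarCurve hw hd, ⟨2 * π, by positivity, fun t => ?_⟩, 0, π / 2, fun h => ?_⟩
  · simp [polarCurve, hper t]
  · have h1 := hw 0
    have h2 := congrArg Prod.fst h
    simp only [polarCurve, cos_pi_div_two, mul_zero, cos_zero, mul_one, inv_eq_zero] at h1 h2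
    linarith

/-- The annular region `|1 / r + cos θ - 3| < 10⁻⁵`. -/
def annulus : Set (ℝ × ℝ) :=
  {p | |1 + p.1 - 3 * √(p.1 ^ 2 + p.2 ^ 2)| < 1 / 10 ^ 5 * √(p.1 ^ 2 + p.2 ^ 2)}

theorem isOpen_annulus : IsOpen annulus := isOpen_lt (by fun_prop) (by fun_prop)

theorem sqrt_polar {r : ℝ} (hr : 0 < r) (t : ℝ) : √((r * cos t) ^ 2 + (r * sin t) ^ 2) = r := by
  rw [mul_pow, mul_pow, ← mul_add, cos_sq_add_sin_sq, mul_one, sqrt_sq hr.le]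

theorem polar_mem_annulus_iff {r : ℝ} (hr : 0 < r) (t : ℝ) :
    (r * cos t, r * sin t) ∈ annulus ↔ |r⁻¹ + cos t - 3| < 1 / 10 ^ 5 := by
  have h : 1 + r * cos t - 3 * r = (r⁻¹ + cos t - 3) * r := by field_simp
  rw [annulus, mem_ofPred_eq, sqrt_polar hr, h, abs_mul, abs_of_pos hr, mul_lt_mul_iff_left₀ hr]

theorem exists_cos_sin_eq {p q : ℝ} (h : p ^ 2 + q ^ 2 = 1) : ∃ τ, cos τ = p ∧ sin τ = q := by
  have hn : ‖(⟨p, q⟩ : ℂ)‖ = 1 := by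
    rw [Complex.norm_def, Complex.normSq_mk, ← sq, ← sq, h, sqrt_one]
  refine ⟨Complex.arg ⟨p, q⟩, ?_, ?_⟩
  · rw [Complex.cos_arg (norm_ne_zero_iff.1 (by rw [hn]; exact one_ne_zero)), hn, div_one]
  · rw [Complex.sin_arg, hn, div_one]

/-- Solutions of a rigid system avoiding the origin rotate with unit angular speed. -/
theorem IsSolutionE.exists_polar {b1 b2 a1 a2 a3 : ℝ} {g : ℝ → ℝ × ℝ}
    (hg : IsSolutionE b1 b2 a1 a2 a3 g) (hne : ∀ t, 0 < (g t).1 ^ 2 + (g t).2 ^ 2) :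
    ∃ (τ : ℝ) (R : ℝ → ℝ), (∀ t, 0 < R t) ∧
      (∀ t, HasDerivAt R (R t * Ffun b1 b2 a1 a2 a3 (R t * cos t) (R t * sin t)) t) ∧
      ∀ t, g (t - τ) = (R t * cos t, R t * sin t) := by
  set F : ℝ → ℝ := fun t => Ffun b1 b2 a1 a2 a3 (g t).1 (g t).2 with hF
  have hx (t : ℝ) : HasDerivAt (fun s => (g s).1) (-(g t).2 + (g t).1 * F t) t :=
    (ContinuousLinearMap.fst ℝ ℝ ℝ).hasFDerivAt.comp_hasDerivAt t (hg t)
  have hy (t : ℝ) : HasDerivAt (fun s => (g s).2) ((g t).1 + (g t).2 * F t) t :=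
    (ContinuousLinearMap.snd ℝ ℝ ℝ).hasFDerivAt.comp_hasDerivAt t (hg t)
  set ρ : ℝ → ℝ := fun t => √((g t).1 ^ 2 + (g t).2 ^ 2) with hρ
  have hρpos (t : ℝ) : 0 < ρ t := sqrt_pos.2 (hne t)
  have hρsq (t : ℝ) : ρ t ^ 2 = (g t).1 ^ 2 + (g t).2 ^ 2 := sq_sqrt (hne t).le
  have hρd (t : ℝ) : HasDerivAt ρ (ρ t * F t) t := by
    convert! (((hx t).pow 2).add ((hy t).pow 2)).sqrt (hne t).ne' using 1
    change _ = _ / (2 * ρ t)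
    rw [eq_div_iff (by linarith [hρpos t])]
    push_cast
    linear_combination 2 * F t * hρsq t
  have hp (t : ℝ) : HasDerivAt (fun s => ((g s).1 * cos s + (g s).2 * sin s) / ρ s) 0 t := by
    convert! (((hx t).mul (hasDerivAt_cos t)).add ((hy t).mul (hasDerivAt_sin t))).div
      (hρd t) (hρpos t).ne' using 1
    simp only [Pi.add_apply, Pi.mul_apply]
    rw [eq_comm, div_eq_zero_iff]
    left
    ring
  have hq (t : ℝ) : HasDerivAt (fun s => ((g s).2 * cos s - (g s).1 * sin s) / ρ s) 0 t := by
    convert! (((hy t).mul (hasDerivAt_cos t)).sub ((hx t).mul (hasDerivAt_sin t))).div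
      (hρd t) (hρpos t).ne' using 1
    simp only [Pi.sub_apply, Pi.mul_apply]
    rw [eq_comm, div_eq_zero_iff]
    left
    ring
  have hpc := is_const_of_deriv_eq_zero (fun t => (hp t).differentiableAt) fun t => (hp t).deriv
  have hqc := is_const_of_deriv_eq_zero (fun t => (hq t).differentiableAt) fun t => (hq t).deriv
  obtain ⟨τ, hτc, hτs⟩ := exists_cos_sin_eq (p := (g 0).1 / ρ 0) (q := (g 0).2 / ρ 0) (by
    rw [div_pow, div_pow, ← add_div, ← hρsq, div_self (pow_ne_zero _ (hρpos 0).ne')])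
  have hpolar (t : ℝ) : g t = (ρ t * cos (t + τ), ρ t * sin (t + τ)) := by
    have h1 := hpc t 0
    have h2 := hqc t 0
    simp only [cos_zero, sin_zero, mul_one, mul_zero, add_zero, sub_zero] at h1 h2
    rw [← hτc, div_eq_iff (hρpos t).ne'] at h1
    rw [← hτs, div_eq_iff (hρpos t).ne'] at h2
    have h3 := sin_sq_add_cos_sq t
    refine Prod.ext ?_ ?_
    · simp only [cos_add]
      linear_combination cos t * h1 - sin t * h2 - (g t).1 * h3
    · simp only [sin_add]
      linear_combination sin t * h1 + cos t * h2 - (g t).2 * h3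
  have hshift (t : ℝ) : g (t - τ) = (ρ (t - τ) * cos t, ρ (t - τ) * sin t) := by
    rw [hpolar, sub_add_cancel]
  refine ⟨τ, fun t => ρ (t - τ), fun t => hρpos _, fun t => ?_, hshift⟩
  have h := (hρd (t - τ)).comp_sub_const t τ
  simp only [hF] at h
  rw [hshift] at h
  exact h

theorem exists_branch_of_orbit {l : ℝ} {g : ℝ → ℝ × ℝ}
    (hg : IsPeriodicOrbitE 0 (-1) (eps * (1 - l)) 0 (-(eps * l)) g) (hU : range g ⊆ annulus) :
    ∃ v : ℝ → ℝ, (∀ t, |v t - 3| ≤ 1 / 10 ^ 5) ∧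
      (∀ t, HasDerivAt v (-eps * (cos t * (cos t ^ 2 - l) / (v t - cos t) ^ 2)) t) ∧
      (∃ n : ℤ, 0 < n ∧ v (n * (2 * π)) = v 0) ∧ range g = range (polarCurve v) := by
  obtain ⟨hsol, ⟨T, hT, hper⟩, -⟩ := hg
  have hmem (t : ℝ) : g t ∈ annulus := hU (mem_range_self t)
  obtain ⟨τ, R, hR, hRd, hgR⟩ := hsol.exists_polar fun t => by
    by_contra! h
    have := hmem t
    rw [annulus, mem_ofPred_eq, sqrt_eq_zero_of_nonpos h, mul_zero, mul_zero] at this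
    exact (abs_nonneg _).not_gt this
  have hgv (t : ℝ) : g (t - τ) = polarCurve (fun s => (R s)⁻¹ + cos s) t := by
    rw [hgR, polarCurve, add_sub_cancel_right, inv_inv]
  refine ⟨fun t => (R t)⁻¹ + cos t, fun t => ?_, fun t => ?_, ?_, ?_⟩
  · exact ((polar_mem_annulus_iff (hR t) t).1 (hgR t ▸ hmem (t - τ))).le
  · convert! ((hRd t).inv (hR t).ne').add (hasDerivAt_cos t) using 1
    rw [Ffun_polar (cos_sq_add_sin_sq t), add_sub_cancel_right]
    have := (hR t).ne'
    field_simp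
    ring
  · have h1 : g (T - τ) = g (0 - τ) := by rw [← hper (0 - τ)]; congr 1; ring
    rw [hgR, hgR] at h1
    have h2 : R T = R 0 := by
      rw [← sqrt_polar (hR T) T, ← sqrt_polar (hR 0) 0, (Prod.mk.inj h1).1, (Prod.mk.inj h1).2]
    have h3 : cos T = 1 := by
      have h4 := congrArg Prod.fst h1
      simp only [h2, cos_zero] at h4
      exact mul_left_cancel₀ (hR 0).ne' h4
    obtain ⟨n, hn⟩ := (cos_eq_one_iff T).1 h3
    refine ⟨n, ?_, ?_⟩
    · rw [← hn] at hT
      exact_mod_cast pos_of_mul_pos_left hT (by positivity)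
    · simp only [hn, h2, h3, cos_zero]
  · rw [← (Equiv.subRight τ).surjective.range_comp g]
    exact congrArg range (funext hgv)

theorem exists_limit_cycle :
    ∃ b1 b2 a1 a2 a3 : ℝ, ∃ f : ℝ → ℝ × ℝ, IsLimitCycleE b1 b2 a1 a2 a3 f := by
  obtain ⟨l, hl, w, hper, hb, hd⟩ := exists_periodic_branch
  have hw (t : ℝ) : 1 ≤ w t - cos t := one_le_sub_cos ((hb t).trans (by norm_num)) t
  have hJ := integral_div_cube_ge hl hper hb hd
  refine ⟨0, -1, eps * (1 - l), 0, -(eps * l), polarCurve w,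
    isPeriodicOrbitE_polarCurve hw hper hd, annulus, isOpen_annulus, ?_, fun g hg hU => ?_⟩
  · rintro _ ⟨t, rfl⟩
    refine (polar_mem_annulus_iff (inv_pos.2 (zero_lt_one.trans_le (hw t))) t).2 ?_
    rw [inv_inv, sub_add_cancel]
    exact (hb t).trans_lt (by norm_num)
  · obtain ⟨v, hvb, hvd, ⟨n, hn, hvn⟩, hrange⟩ := exists_branch_of_orbit hg hU
    have hwn : w (n * (2 * π)) = w 0 := by
      have := hper.int_mul n 0
      rwa [zero_add] at this
    rw [hrange, branch_unique hl hJ hvb (fun t => (hb t).trans (by norm_num)) hvd hd hn hvn hwn]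
end

section
/- If a2^2 - 4*a1*a3 < 0, then the set of zeros of the vector field X on the equator {(z1,z2,0) : z1^2 + z2^2 = 1} is exactly {(0,1,0), (0,-1,0)}; in particular X has exactly two critical points on the equator. -/
/-- The compactified vector field on the Poincaré sphere; a point of `ℝ × ℝ × ℝ`
is written `z = (z₁, z₂, z₃)` with `z.1 = z₁`, `z.2.1 = z₂`, `z.2.2 = z₃`. -/
noncomputable def Xfield (b1 b2 a1 a2 a3 : ℝ) (z : ℝ × ℝ × ℝ) : ℝ × ℝ × ℝ :=
  (z.2.2 * (-z.2.1 * z.2.2 + b1 * z.1^2 * z.2.2^2 + b2 * z.1 * z.2.1 * z.2.2^2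
      + a1 * z.1^4 + a2 * z.1^3 * z.2.1 + a3 * z.1^2 * z.2.1^2),
   z.2.2 * (z.1 * z.2.2 + b1 * z.1 * z.2.1 * z.2.2^2 + b2 * z.2.1^2 * z.2.2^2
      + a1 * z.1^3 * z.2.1 + a2 * z.1^2 * z.2.1^2 + a3 * z.1 * z.2.1^3),
   (z.2.2^2 - 1) * (b1 * z.1 * z.2.2^2 + b2 * z.2.1 * z.2.2^2
      + a1 * z.1^3 + a2 * z.1^2 * z.2.1 + a3 * z.1 * z.2.1^2))

/-- A real binary quadratic form with negative discriminant vanishes at `(x, y)` only if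
`x = 0`. -/
theorem eq_zero_of_quadratic_form_eq_zero {a b c x y : ℝ} (hD : b^2 - 4*a*c < 0)
    (h : a * x^2 + b * x * y + c * y^2 = 0) : x = 0 := by
  have key : (2*c*y + b*x)^2 + (4*a*c - b^2) * x^2 = 0 := by
    linear_combination 4 * c * h
  by_contra hx
  have : 0 < (4*a*c - b^2) * x^2 := mul_pos (by linarith) (by positivity)
  nlinarith [sq_nonneg (2*c*y + b*x)]

theorem two_equator_critical_points (b1 b2 a1 a2 a3 : ℝ)
    (hD : a2^2 - 4*a1*a3 < 0) :
    {z : ℝ × ℝ × ℝ | z.1^2 + z.2.1^2 = 1 ∧ z.2.2 = 0 ∧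
        Xfield b1 b2 a1 a2 a3 z = 0} =
      {((0:ℝ), (1:ℝ), (0:ℝ)), ((0:ℝ), (-1:ℝ), (0:ℝ))} := by
  ext ⟨x, y, w⟩
  simp only [Set.mem_ofPred_eq, Set.mem_insert_iff, Set.mem_singleton_iff, Prod.mk.injEq]
  constructor
  · rintro ⟨hxy, rfl, hX⟩
    have h3 : x * (a1 * x^2 + a2 * x * y + a3 * y^2) = 0 := by
      have h := congrArg (fun p : ℝ × ℝ × ℝ => p.2.2) hX
      simp only [Xfield, Prod.snd_zero] at h
      linear_combination -h
    have hx : x = 0 :=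
      (mul_eq_zero.mp h3).elim id (eq_zero_of_quadratic_form_eq_zero hD)
    subst hx
    have hy : y = 1 ∨ y = -1 := by
      have h : (y - 1) * (y + 1) = 0 := by linear_combination hxy
      exact (mul_eq_zero.mp h).imp sub_eq_zero.mp eq_neg_of_add_eq_zero_left
    simpa using hy
  · rintro (⟨rfl, rfl, rfl⟩ | ⟨rfl, rfl, rfl⟩) <;> simp [Xfield]
end

section
/- If a3 ≠ 0 and a2^2 - 4*a1*a3 > 0, then the vector field X has exactly six zeros on the equator {(z1,z2,0) : z1^2 + z2^2 = 1}, and these zeros come in three antipodal pairs (if p is a zero on the equator then so is -p). -/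
/-- On the equator, `Xfield` vanishes exactly where a cubic form does. -/
theorem Xfield_equator_eq_zero_iff (b1 b2 a1 a2 a3 x y : ℝ) :
    Xfield b1 b2 a1 a2 a3 (x, y, 0) = 0 ↔ x * (a1 * x^2 + a2 * x * y + a3 * y^2) = 0 := by
  have h : Xfield b1 b2 a1 a2 a3 (x, y, 0) =
      (0, 0, -(x * (a1 * x^2 + a2 * x * y + a3 * y^2))) := by
    simp only [Xfield, Prod.mk.injEq]
    exact ⟨by ring, by ring, by ring⟩
  rw [h]
  simp only [Prod.mk_eq_zero, true_and, neg_eq_zero]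

/-- A quadratic form with positive discriminant splits into two distinct lines. -/
theorem exists_ne_forall_quadratic_form_eq {a1 a2 a3 : ℝ} (ha3 : a3 ≠ 0)
    (hD : a2^2 - 4*a1*a3 > 0) :
    ∃ r s : ℝ, r ≠ s ∧
      ∀ x y : ℝ, a1 * x^2 + a2 * x * y + a3 * y^2 = a3 * (y - r * x) * (y - s * x) := by
  have hsq : √(a2^2 - 4*a1*a3) ^ 2 = a2^2 - 4*a1*a3 := Real.sq_sqrt hD.le
  have hpos : 0 < √(a2^2 - 4*a1*a3) := Real.sqrt_pos.mpr hD
  generalize √(a2^2 - 4*a1*a3) = d at hsq hpos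
  refine ⟨(-a2 + d) / (2 * a3), (-a2 - d) / (2 * a3), fun h => ?_, fun x y => ?_⟩
  · field_simp at h
    linarith
  · field_simp
    linear_combination x ^ 2 * hsq

/-- The line of slope `r` through the origin meets the unit circle in two antipodal points. -/
theorem exists_pos_unit_circle_line_iff (r : ℝ) :
    ∃ c : ℝ, 0 < c ∧ ∀ x y : ℝ, x^2 + y^2 = 1 ∧ y = r * x ↔
      (x = c ∧ y = r * c) ∨ (x = -c ∧ y = -(r * c)) := by
  have hc : (√(1 + r ^ 2))⁻¹ ^ 2 * (1 + r ^ 2) = 1 := by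
    rw [inv_pow, Real.sq_sqrt (by positivity), inv_mul_cancel₀ (by positivity)]
  have hpos : 0 < (√(1 + r ^ 2))⁻¹ := by positivity
  generalize (√(1 + r ^ 2))⁻¹ = c at hc hpos
  refine ⟨c, hpos, fun x y => ⟨?_, ?_⟩⟩
  · rintro ⟨h, rfl⟩
    have hx : x ^ 2 = c ^ 2 := by
      have hr : (1 + r ^ 2) ≠ 0 := by positivity
      apply mul_right_cancel₀ hr
      linear_combination h - hc
    rcases sq_eq_sq_iff_eq_or_eq_neg.mp hx with rfl | rfl
    · exact Or.inl ⟨rfl, rfl⟩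
    · exact Or.inr ⟨rfl, by ring⟩
  · rintro (⟨rfl, rfl⟩ | ⟨rfl, rfl⟩)
    · exact ⟨by linear_combination hc, rfl⟩
    · exact ⟨by linear_combination hc, by ring⟩

theorem six_equator_critical_points (b1 b2 a1 a2 a3 : ℝ)
    (ha3 : a3 ≠ 0) (hD : a2^2 - 4*a1*a3 > 0) :
    ({z : ℝ × ℝ × ℝ | z.1^2 + z.2.1^2 = 1 ∧ z.2.2 = 0 ∧
        Xfield b1 b2 a1 a2 a3 z = 0}).ncard = 6 ∧
      ∀ z : ℝ × ℝ × ℝ,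
        z ∈ {z : ℝ × ℝ × ℝ | z.1^2 + z.2.1^2 = 1 ∧ z.2.2 = 0 ∧
          Xfield b1 b2 a1 a2 a3 z = 0} →
        -z ∈ {z : ℝ × ℝ × ℝ | z.1^2 + z.2.1^2 = 1 ∧ z.2.2 = 0 ∧
          Xfield b1 b2 a1 a2 a3 z = 0} := by
  constructor
  · obtain ⟨r, s, hrs, hfac⟩ := exists_ne_forall_quadratic_form_eq ha3 hD
    obtain ⟨c, hc, hline_r⟩ := exists_pos_unit_circle_line_iff r
    obtain ⟨d, hd, hline_s⟩ := exists_pos_unit_circle_line_iff s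
    have hset : {z : ℝ × ℝ × ℝ | z.1^2 + z.2.1^2 = 1 ∧ z.2.2 = 0 ∧
        Xfield b1 b2 a1 a2 a3 z = 0} =
        (({(0, 1, 0), (0, -1, 0), (c, r * c, 0), (-c, -(r * c), 0), (d, s * d, 0),
          (-d, -(s * d), 0)} : Finset (ℝ × ℝ × ℝ)) : Set (ℝ × ℝ × ℝ)) := by
      ext ⟨x, y, w⟩
      simp only [Set.mem_ofPred_eq, Finset.coe_insert, Finset.coe_singleton,
        Set.mem_insert_iff, Set.mem_singleton_iff, Prod.mk.injEq]
      by_cases hw : w = 0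
      · subst hw
        have hvert : x^2 + y^2 = 1 ∧ x = 0 ↔ (x = 0 ∧ y = 1) ∨ (x = 0 ∧ y = -1) := by
          rw [← and_or_left, and_comm, and_congr_right_iff]
          rintro rfl
          simp
        simp only [Xfield_equator_eq_zero_iff, hfac, mul_eq_zero, ha3, false_or, sub_eq_zero,
          true_and, and_true, and_or_left, hvert, hline_r, hline_s, or_assoc]
      · simp only [hw, false_and, and_false, or_self]
    rw [hset, Set.ncard_coe_finset]
    have hcd : c = d → r * c ≠ s * d := by
      rintro rfl h
      exact hrs (mul_right_cancel₀ hc.ne' h)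
    repeat rw [Finset.card_insert_of_notMem]
    · simp
    all_goals
      simp only [Finset.mem_insert, Finset.mem_singleton, Prod.mk.injEq]
      grind
  · rintro ⟨x, y, w⟩ ⟨h, hw, hX⟩
    obtain rfl : w = 0 := hw
    rw [Xfield_equator_eq_zero_iff] at hX
    simp only [Set.mem_ofPred_eq, Prod.neg_mk, neg_zero, true_and]
    refine ⟨by linear_combination h, ?_⟩
    rw [Xfield_equator_eq_zero_iff]
    linear_combination -hX
end

section
/- The only zeros of the vector field X on the unit sphere outside the equator are the two poles: if z = (z1,z2,z3) satisfies z1^2 + z2^2 + z3^2 = 1, z3 ≠ 0 and X(z) = 0, then z = (0,0,1) or z = (0,0,-1); conversely, X(0,0,1) = 0 and X(0,0,-1) = 0. -/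
theorem poles_only_finite_critical_points (b1 b2 a1 a2 a3 : ℝ) :
    (∀ z : ℝ × ℝ × ℝ, z.1^2 + z.2.1^2 + z.2.2^2 = 1 → z.2.2 ≠ 0 →
        Xfield b1 b2 a1 a2 a3 z = 0 →
        z = ((0:ℝ), (0:ℝ), (1:ℝ)) ∨ z = ((0:ℝ), (0:ℝ), (-1:ℝ))) ∧
      Xfield b1 b2 a1 a2 a3 ((0:ℝ), (0:ℝ), (1:ℝ)) = 0 ∧
      Xfield b1 b2 a1 a2 a3 ((0:ℝ), (0:ℝ), (-1:ℝ)) = 0 := by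
  refine ⟨?_, by simp [Xfield], by simp [Xfield]⟩
  rintro ⟨x, y, w⟩ hsphere hw hX
  simp only [Xfield, Prod.mk_eq_zero] at hsphere hw hX
  obtain ⟨hX₁, hX₂, -⟩ := hX
  have hxy : x ^ 2 + y ^ 2 = 0 := by
    have h : w ^ 2 * (x ^ 2 + y ^ 2) = 0 := by linear_combination x * hX₂ - y * hX₁
    exact (mul_eq_zero.mp h).resolve_left (pow_ne_zero 2 hw)
  have hx : x = 0 := pow_eq_zero_iff two_ne_zero |>.mp (by linarith [sq_nonneg x, sq_nonneg y])
  have hy : y = 0 := pow_eq_zero_iff two_ne_zero |>.mp (by linarith [sq_nonneg x, sq_nonneg y])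
  have hw1 : w = 1 ∨ w = -1 := eq_or_eq_neg_of_sq_eq_sq w 1 (by linarith)
  simpa [hx, hy] using hw1
end

section
/- Assume b1 = 0 and b2 = 0. Define H(z1,z2,z3) = (-z3^3 + a2*z1^3 - 3*a1*z1^2*z2 - (2*a1 + a3)*z2^3) / (3*(z1^2 + z2^2)^(3/2)). Then H is a first integral of the system (S) away from the poles: for every solution f : I -> R^3 of (S) with (f1(t))^2 + (f2(t))^2 ≠ 0 for all t in I, the function t ↦ H(f(t)) is constant on I. -/
/-- `f` is a solution of the system (S) on the set `I`. -/
def IsSolutionOnS (b1 b2 a1 a2 a3 : ℝ) (f : ℝ → ℝ × ℝ × ℝ) (I : Set ℝ) : Prop :=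
  ∀ t ∈ I, HasDerivWithinAt f (Xfield b1 b2 a1 a2 a3 (f t)) I t

/-- The first integral on the sphere for the case `b1 = b2 = 0`. -/
noncomputable def Hsph (a1 a2 a3 : ℝ) (z : ℝ × ℝ × ℝ) : ℝ :=
  (-z.2.2^3 + a2*z.1^3 - 3*a1*z.1^2*z.2.1 - (2*a1 + a3)*z.2.1^3) /
    (3 * Real.sqrt ((z.1^2 + z.2.1^2)^3))

/-- Along a solution with `b1 = b2 = 0`, the function `Hsph` has zero derivative off the poles. -/
lemma hasDerivWithinAt_Hsph {a1 a2 a3 t : ℝ} {I : Set ℝ} {f : ℝ → ℝ × ℝ × ℝ}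
    (hf : HasDerivWithinAt f (Xfield 0 0 a1 a2 a3 (f t)) I t)
    (hne : (f t).1^2 + (f t).2.1^2 ≠ 0) :
    HasDerivWithinAt (fun s => Hsph a1 a2 a3 (f s)) 0 I t := by
  have hx : HasDerivWithinAt (fun s => (f s).1) (Xfield 0 0 a1 a2 a3 (f t)).1 I t := by
    simpa using hf.hasFDerivWithinAt.fst.hasDerivWithinAt
  have hyz : HasDerivWithinAt (fun s => (f s).2) (Xfield 0 0 a1 a2 a3 (f t)).2 I t := by
    simpa using hf.hasFDerivWithinAt.snd.hasDerivWithinAt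
  have hy : HasDerivWithinAt (fun s => (f s).2.1) (Xfield 0 0 a1 a2 a3 (f t)).2.1 I t := by
    simpa using hyz.hasFDerivWithinAt.fst.hasDerivWithinAt
  have hz : HasDerivWithinAt (fun s => (f s).2.2) (Xfield 0 0 a1 a2 a3 (f t)).2.2 I t := by
    simpa using hyz.hasFDerivWithinAt.snd.hasDerivWithinAt
  have hpos : 0 < ((f t).1^2 + (f t).2.1^2)^3 := by positivity
  have hS : 0 < √(((f t).1^2 + (f t).2.1^2)^3) := Real.sqrt_pos.mpr hpos
  have hnum := (((hz.fun_pow 3).fun_neg.fun_add ((hx.fun_pow 3).const_mul a2)).fun_sub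
    (((hx.fun_pow 2).const_mul (3 * a1)).fun_mul hy)).fun_sub
      ((hy.fun_pow 3).const_mul (2 * a1 + a3))
  have hden := ((((hx.fun_pow 2).fun_add (hy.fun_pow 2)).fun_pow 3).sqrt hpos.ne').const_mul 3
  have hquot := hnum.fun_div hden (by positivity)
  unfold Hsph
  refine hquot.congr_deriv ?_
  have hsq := Real.sq_sqrt hpos.le
  simp only [Xfield]
  generalize √(((f t).1^2 + (f t).2.1^2)^3) = S at hS hsq ⊢
  generalize (f t).1 = x, (f t).2.1 = y, (f t).2.2 = z at hsq ⊢
  field_simp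
  rw [hsq]
  push_cast
  ring

theorem first_integral_sphere (b1 b2 a1 a2 a3 : ℝ)
    (hb1 : b1 = 0) (hb2 : b2 = 0)
    (I : Set ℝ) (hI : I.OrdConnected)
    (f : ℝ → ℝ × ℝ × ℝ) (hf : IsSolutionOnS b1 b2 a1 a2 a3 f I)
    (hne : ∀ t ∈ I, (f t).1^2 + (f t).2.1^2 ≠ 0) :
    ∀ t ∈ I, ∀ s ∈ I, Hsph a1 a2 a3 (f t) = Hsph a1 a2 a3 (f s) := by
  subst hb1 hb2
  intro t ht s hs
  have h := hI.convex.norm_image_sub_le_of_norm_hasDerivWithin_le (C := 0)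
    (fun u hu => hasDerivWithinAt_Hsph (hf u hu) (hne u hu)) (by simp) hs ht
  rw [zero_mul, norm_le_zero_iff, sub_eq_zero] at h
  exact h
end

section
/- Assume a2^2 - 4*a1*a3 < 0 (so X has exactly two critical points on the equator, which are cusps). Then the system (S) has a periodic solution on the unit sphere that is symmetric with respect to the origin and crosses the equator at regular points: there exist T > 0 and a solution f : R -> R^3 of (S) with (f1(t))^2 + (f2(t))^2 + (f3(t))^2 = 1 for all t, f(t+T) = -f(t) for all t (hence f is 2T-periodic and its orbit is symmetric with respect to the origin), and there exists t0 with f3(t0) = 0 and X(f(t0)) ≠ 0. -/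
/-- `f : ℝ → ℝ × ℝ × ℝ` is a (global) solution of the system (S). -/
def IsSolutionS (b1 b2 a1 a2 a3 : ℝ) (f : ℝ → ℝ × ℝ × ℝ) : Prop :=
  ∀ t : ℝ, HasDerivAt f (Xfield b1 b2 a1 a2 a3 (f t)) t

section

open Set Filter Topology Real
open scoped NNReal

theorem exists_hasDerivAt_of_bounded_lipschitz {E : Type*} [NormedAddCommGroup E]
    [NormedSpace ℝ E] [CompleteSpace E] {f : ℝ → E → E} {K L : ℝ≥0}
    (hlip : ∀ t, LipschitzWith K (f t)) (hcont : ∀ x, Continuous fun t => f t x)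
    (hbound : ∀ t x, ‖f t x‖ ≤ L) (t₀ : ℝ) (x₀ : E) :
    ∃ α : ℝ → E, α t₀ = x₀ ∧ ∀ t, HasDerivAt α (f t (α t)) t := by
  have local_solution : ∀ n : ℕ, ∃ α : ℝ → E, α t₀ = x₀ ∧
      ∀ t ∈ Ioo (t₀ - (n + 1)) (t₀ + (n + 1)), HasDerivAt α (f t (α t)) t := by
    intro n
    have hn : (0 : ℝ) < n + 1 := by positivity
    have hmem : t₀ ∈ Icc (t₀ - (n + 1)) (t₀ + (n + 1)) := by constructor <;> linarith
    have hpl : IsPicardLindelof f ⟨t₀, hmem⟩ x₀ (L * (n + 1)) 0 L K :=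
      { lipschitzOnWith := fun t _ => (hlip t).lipschitzOnWith
        continuousOn := fun x _ => (hcont x).continuousOn
        norm_le := fun t _ x _ => hbound t x
        mul_max_le := by simp }
    obtain ⟨α, h0, hα⟩ := hpl.exists_eq_forall_mem_Icc_hasDerivWithinAt₀
    exact ⟨α, h0, fun t ht => (hα t (Ioo_subset_Icc_self ht)).hasDerivAt (Icc_mem_nhds ht.1 ht.2)⟩
  choose α h0 hα using local_solution
  have agree_of_le : ∀ m n : ℕ, m ≤ n → ∀ s, |s - t₀| < m + 1 → α m s = α n s := by
    intro m n hmn s hs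
    have hmn' : (m : ℝ) ≤ n := by exact_mod_cast hmn
    rw [abs_lt] at hs
    have hm : (0 : ℝ) < m + 1 := by positivity
    refine ODE_solution_unique_of_mem_Ioo (v := f) (s := fun _ => univ) (K := K) (t₀ := t₀)
      (a := t₀ - (m + 1)) (b := t₀ + (m + 1)) (fun t _ => (hlip t).lipschitzOnWith)
      ⟨by linarith, by linarith⟩ (fun t ht => ⟨hα m t ht, trivial⟩)
      (fun t ht => ⟨hα n t ⟨by linarith [ht.1], by linarith [ht.2]⟩, trivial⟩)
      ((h0 m).trans (h0 n).symm) ⟨by linarith, by linarith⟩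
  refine ⟨fun t => α ⌈|t - t₀|⌉₊ t, h0 _, fun t => ?_⟩
  set N := ⌈|t - t₀|⌉₊ with hN
  have ht : |t - t₀| < N + 1 := (Nat.le_ceil _).trans_lt (lt_add_one _)
  have hev : (fun t => α ⌈|t - t₀|⌉₊ t) =ᶠ[𝓝 t] α N := by
    have : ∀ᶠ s in 𝓝 t, |s - t₀| < N + 1 :=
      ContinuousAt.eventually_lt (by fun_prop) continuousAt_const ht
    filter_upwards [this] with s hs
    rcases le_total ⌈|s - t₀|⌉₊ N with h | h
    · exact agree_of_le _ _ h s ((Nat.le_ceil _).trans_lt (lt_add_one _))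
    · exact (agree_of_le _ _ h s hs).symm
  refine HasDerivAt.congr_of_eventuallyEq ?_ hev
  rw [abs_lt] at ht
  exact hα N t ⟨by linarith, by linarith⟩

theorem Function.Periodic.exists_abs_le {g : ℝ → ℝ} {c : ℝ} (hg : Function.Periodic g c)
    (hc : 0 < c) (hcont : Continuous g) : ∃ M, ∀ x, |g x| ≤ M := by
  obtain ⟨M, hM⟩ := (isCompact_Icc (a := (0 : ℝ)) (b := c)).exists_bound_of_continuousOn
    hcont.continuousOn
  refine ⟨M, fun x => ?_⟩
  obtain ⟨y, hy, hxy⟩ := hg.exists_mem_Ico₀ hc x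
  rw [hxy]
  exact hM y (Ico_subset_Icc_self hy)

theorem Function.Periodic.exists_lipschitz {g : ℝ → ℝ} {c : ℝ} (hg : Function.Periodic g c)
    (hc : 0 < c) (hdiff : ContDiff ℝ 1 g) :
    ∃ K ≥ 0, ∀ x y, |g x - g y| ≤ K * |x - y| := by
  have hper : Function.Periodic (deriv g) c := by
    intro x
    rw [← deriv_comp_add_const, show (fun y => g (y + c)) = g from funext hg]
  obtain ⟨K, hK⟩ := hper.exists_abs_le hc (hdiff.continuous_deriv le_rfl)
  refine ⟨K, (abs_nonneg _).trans (hK 0), fun x y => ?_⟩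
  exact Convex.norm_image_sub_le_of_norm_deriv_le (s := univ)
    (fun z _ => (hdiff.differentiable one_ne_zero).differentiableAt) (fun z _ => hK z)
    convex_univ (mem_univ y) (mem_univ x)

/-- The right-hand side of the regularized equation for `u = cot φ` as a function of the
longitude, where `φ` is the colatitude. -/
noncomputable def regularizedSlope (A B : ℝ → ℝ) (ε θ u : ℝ) : ℝ :=
  -(B θ * u ^ 2 + A θ) / (u ^ 2 + ε)

theorem regularizedSlope_neg (A B : ℝ → ℝ) (ε θ u : ℝ) :
    regularizedSlope (-A) (-B) ε θ (-u) = -regularizedSlope A B ε θ u := by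
  simp only [regularizedSlope, Pi.neg_apply]
  ring

theorem abs_mul_sq_add_le {x y M : ℝ} (hx : |x| ≤ M) (hy : |y| ≤ M) (u : ℝ) :
    |x * u ^ 2 + y| ≤ M * (u ^ 2 + 1) := by
  rw [abs_le] at *
  constructor <;> nlinarith [sq_nonneg u]

theorem abs_regularizedSlope_le_of_one_le {A B : ℝ → ℝ} {M ε θ u : ℝ} (hA : |A θ| ≤ M)
    (hB : |B θ| ≤ M) (hε : 0 < ε) (hu : 1 ≤ u ^ 2) :
    |regularizedSlope A B ε θ u| ≤ 2 * M := by
  have hpos : 0 < u ^ 2 + ε := by positivity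
  have hM : 0 ≤ M := (abs_nonneg _).trans hA
  rw [regularizedSlope, abs_div, abs_neg, abs_of_pos hpos, div_le_iff₀ hpos]
  have := abs_mul_sq_add_le hB hA u
  nlinarith [mul_nonneg hM hε.le]

theorem abs_regularizedSlope_le {A B : ℝ → ℝ} {M ε θ : ℝ} (hA : |A θ| ≤ M)
    (hB : |B θ| ≤ M) (hε : 0 < ε) (u : ℝ) :
    |regularizedSlope A B ε θ u| ≤ M * (1 + 1 / ε) := by
  have hpos : 0 < u ^ 2 + ε := by positivity
  have hM : 0 ≤ M := (abs_nonneg _).trans hA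
  rw [regularizedSlope, abs_div, abs_neg, abs_of_pos hpos, div_le_iff₀ hpos]
  refine (abs_mul_sq_add_le hB hA u).trans ?_
  rw [mul_assoc]
  refine mul_le_mul_of_nonneg_left ?_ hM
  have h1 : (1 + 1 / ε) * (u ^ 2 + ε) = u ^ 2 + 1 + ε + u ^ 2 / ε := by field_simp; ring
  have h2 : 0 ≤ u ^ 2 / ε := by positivity
  linarith

theorem regularizedSlope_lipschitz {A B : ℝ → ℝ} {M ε θ : ℝ} (hA : |A θ| ≤ M)
    (hB : |B θ| ≤ M) (hε : 0 < ε) (hε1 : ε ≤ 1) (u w : ℝ) :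
    |regularizedSlope A B ε θ u - regularizedSlope A B ε θ w| ≤ 2 * M / ε ^ 2 * |u - w| := by
  have hu : 0 < u ^ 2 + ε := by positivity
  have hw : 0 < w ^ 2 + ε := by positivity
  have hM : 0 ≤ M := (abs_nonneg _).trans hA
  have key : regularizedSlope A B ε θ u - regularizedSlope A B ε θ w =
      -((B θ * ε - A θ) * ((u + w) / ((u ^ 2 + ε) * (w ^ 2 + ε))) * (u - w)) := by
    simp only [regularizedSlope]
    field_simp
    ring
  rw [key, abs_neg, abs_mul, abs_mul]
  refine mul_le_mul_of_nonneg_right ?_ (abs_nonneg _)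
  have h1 : |B θ * ε - A θ| ≤ 2 * M := by
    rw [abs_le] at *
    constructor <;> nlinarith
  have h2 : |(u + w) / ((u ^ 2 + ε) * (w ^ 2 + ε))| ≤ 1 / ε ^ 2 := by
    rw [abs_div, abs_of_pos (mul_pos hu hw), div_le_div_iff₀ (mul_pos hu hw) (by positivity),
      one_mul]
    have h3 : 2 * |u| * ε ≤ u ^ 2 + ε := by nlinarith [sq_nonneg (|u| - ε), sq_abs u]
    have h4 : 2 * |w| * ε ≤ w ^ 2 + ε := by nlinarith [sq_nonneg (|w| - ε), sq_abs w]
    have h5 := mul_le_mul h3 (by nlinarith [sq_nonneg w] : ε ≤ w ^ 2 + ε) hε.le hu.le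
    have h6 := mul_le_mul h4 (by nlinarith [sq_nonneg u] : ε ≤ u ^ 2 + ε) hε.le hw.le
    nlinarith [mul_le_mul_of_nonneg_right (abs_add_le u w) (sq_nonneg ε)]
  calc _ ≤ 2 * M * (1 / ε ^ 2) := mul_le_mul h1 h2 (abs_nonneg _) (by positivity)
    _ = _ := by ring

theorem le_of_hasDerivAt_regularizedSlope {A B u : ℝ → ℝ} {M ε a b r : ℝ}
    (hA : ∀ θ, |A θ| ≤ M) (hB : ∀ θ, |B θ| ≤ M) (hε : 0 < ε)
    (hu : ∀ θ, HasDerivAt u (regularizedSlope A B ε θ (u θ)) θ) (hr : 1 ≤ r) (ha : u a ≤ r) :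
    ∀ θ ∈ Icc a b, u θ ≤ r + (2 * M + 1) * (θ - a) := by
  have hM : 0 ≤ M := (abs_nonneg _).trans (hA 0)
  have hline : ∀ x, HasDerivAt (fun θ => r + (2 * M + 1) * (θ - a)) (2 * M + 1) x := fun x => by
    simpa using (((hasDerivAt_id x).sub_const a).const_mul (2 * M + 1)).const_add r
  refine image_le_of_deriv_right_lt_deriv_boundary'
    (fun x _ => (hu x).continuousAt.continuousWithinAt)
    (fun x _ => (hu x).hasDerivWithinAt) (by simpa using ha) (by fun_prop)
    (fun x _ => (hline x).hasDerivWithinAt) fun x hx hux => ?_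
  have h1 : 1 ≤ u x := by
    rw [hux]
    nlinarith [hx.1]
  have := abs_regularizedSlope_le_of_one_le (hA x) (hB x) hε (u := u x) (by nlinarith)
  linarith [le_abs_self (regularizedSlope A B ε x (u x))]

theorem ge_of_hasDerivAt_regularizedSlope {A B u : ℝ → ℝ} {M ε a b : ℝ}
    (hA : ∀ θ, |A θ| ≤ M) (hB : ∀ θ, |B θ| ≤ M) (hε : 0 < ε)
    (hu : ∀ θ, HasDerivAt u (regularizedSlope A B ε θ (u θ)) θ)
    (ha : 1 + (2 * M + 1) * (b - a) ≤ u a) :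
    ∀ θ ∈ Icc a b, 1 + (2 * M + 1) * (b - θ) ≤ u θ := by
  have hM : 0 ≤ M := (abs_nonneg _).trans (hA 0)
  have hline : ∀ x, HasDerivAt (fun θ => -(1 + (2 * M + 1) * (b - θ))) (2 * M + 1) x := fun x => by
    exact ((((hasDerivAt_id x).const_sub b).const_mul (2 * M + 1)).const_add 1).fun_neg.congr_deriv
      (by ring)
  have := image_le_of_deriv_right_lt_deriv_boundary' (f := -u) (a := a) (b := b)
    (B := fun θ => -(1 + (2 * M + 1) * (b - θ)))
    (fun x _ => (hu x).neg.continuousAt.continuousWithinAt)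
    (fun x _ => (hu x).neg.hasDerivWithinAt) (neg_le_neg ha) (by fun_prop)
    (fun x _ => (hline x).hasDerivWithinAt) fun x hx hux => ?_
  · exact fun θ hθ => neg_le_neg_iff.1 (this hθ)
  have h1 : 1 ≤ u x := by
    simp only [Pi.neg_apply, neg_inj] at hux
    rw [hux]
    nlinarith [hx.2]
  have := abs_regularizedSlope_le_of_one_le (hA x) (hB x) hε (u := u x) (by nlinarith)
  linarith [neg_abs_le (regularizedSlope A B ε x (u x))]

theorem exists_regularized_solution_antiperiodic {A B : ℝ → ℝ} {M ε a b : ℝ}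
    (hAc : Continuous A) (hBc : Continuous B) (hA : ∀ θ, |A θ| ≤ M) (hB : ∀ θ, |B θ| ≤ M)
    (hε : 0 < ε) (hε1 : ε ≤ 1) (hab : a ≤ b) :
    ∃ u : ℝ → ℝ, (∀ θ, HasDerivAt u (regularizedSlope A B ε θ (u θ)) θ) ∧ u b = -u a ∧
      ∀ θ ∈ Icc a b, |u θ| ≤ 1 + 2 * ((2 * M + 1) * (b - a)) := by
  have hM : 0 ≤ M := (abs_nonneg _).trans (hA 0)
  have hlip : ∀ θ, LipschitzWith ⟨2 * M / ε ^ 2, by positivity⟩ (regularizedSlope A B ε θ) :=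
    fun θ => LipschitzWith.of_dist_le_mul fun x y =>
      regularizedSlope_lipschitz (hA θ) (hB θ) hε hε1 x y
  have hflow : ∀ x : ℝ, ∃ u : ℝ → ℝ, u a = x ∧
      ∀ θ, HasDerivAt u (regularizedSlope A B ε θ (u θ)) θ := fun x =>
    exists_hasDerivAt_of_bounded_lipschitz (L := ⟨M * (1 + 1 / ε), by positivity⟩) hlip
      (fun x => by unfold regularizedSlope; fun_prop)
      (fun θ u => abs_regularizedSlope_le (hA θ) (hB θ) hε u) a x
  choose u hua hu using hflow
  have hcont : ∀ x, Continuous (u x) := fun x =>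
    continuous_iff_continuousAt.2 fun θ => (hu x θ).continuousAt
  have hend : Continuous fun x => u x b := by
    refine (LipschitzWith.of_dist_le_mul
      (K := ⟨exp (2 * M / ε ^ 2 * (b - a)), (exp_pos _).le⟩) fun x y => ?_).continuous
    have := dist_le_of_trajectories_ODE (δ := dist x y) hlip (hcont x).continuousOn
      (fun θ _ => (hu x θ).hasDerivWithinAt) (hcont y).continuousOn
      (fun θ _ => (hu y θ).hasDerivWithinAt) (by rw [hua, hua]) b (right_mem_Icc.2 hab)
    rw [mul_comm]
    exact this
  have hneg : ∀ x θ, HasDerivAt (-u x) (regularizedSlope (-A) (-B) ε θ ((-u x) θ)) θ :=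
    fun x θ => by
      rw [Pi.neg_apply, regularizedSlope_neg]
      exact (hu x θ).neg
  have hA' : ∀ θ, |(-A) θ| ≤ M := fun θ => by simpa using hA θ
  have hB' : ∀ θ, |(-B) θ| ≤ M := fun θ => by simpa using hB θ
  set R := 1 + (2 * M + 1) * (b - a) with hR
  have hR1 : 1 ≤ R := by nlinarith
  obtain ⟨x, hx, hx0⟩ : ∃ x ∈ Icc (-R) R, u x b + x = 0 := by
    refine intermediate_value_Icc (by linarith) (f := fun x => u x b + x)
      (hend.add continuous_id).continuousOn ⟨?_, ?_⟩
    · have := ge_of_hasDerivAt_regularizedSlope (b := b) hA' hB' hε (hneg (-R))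
        (by simp [hua, hR]) b (right_mem_Icc.2 hab)
      simp only [Pi.neg_apply, sub_self, mul_zero] at this
      linarith
    · have := ge_of_hasDerivAt_regularizedSlope (b := b) hA hB hε (hu R)
        (by rw [hua]) b (right_mem_Icc.2 hab)
      simp only [sub_self, mul_zero] at this
      linarith
  refine ⟨u x, hu x, by rw [hua]; linarith, fun θ hθ => ?_⟩
  have h1 := le_of_hasDerivAt_regularizedSlope (b := b) hA hB hε (hu x) hR1 (by rw [hua]; exact hx.2)
    θ hθ
  have h2 := le_of_hasDerivAt_regularizedSlope (b := b) hA' hB' hε (hneg x) hR1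
    (by rw [Pi.neg_apply, hua]; linarith [hx.1]) θ hθ
  have h3 : (2 * M + 1) * (θ - a) ≤ (2 * M + 1) * (b - a) := by nlinarith [hθ.2]
  rw [Pi.neg_apply] at h2
  rw [abs_le]
  constructor <;> linarith

theorem exists_subseq_tendsto_of_cube_modulus {a b C R : ℝ} (hab : a ≤ b) (u : ℕ → ℝ → ℝ)
    (hcont : ∀ n, Continuous (u n)) (hbound : ∀ n, ∀ θ ∈ Icc a b, |u n θ| ≤ R)
    (hmod : ∀ n, ∀ x y, x ∈ Icc a b → y ∈ Icc a b → |u n x - u n y| ^ 3 ≤ C * |x - y|) :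
    ∃ g : ℝ → ℝ, Continuous g ∧ ∃ φ : ℕ → ℕ, StrictMono φ ∧
      ∀ θ ∈ Icc a b, Tendsto (fun n => u (φ n) θ) atTop (𝓝 (g θ)) := by
  let F : ℕ → BoundedContinuousFunction (Icc a b) ℝ := fun n =>
    BoundedContinuousFunction.mkOfCompact ⟨fun x => u n x, (hcont n).comp continuous_subtype_val⟩
  have hF : ∀ n x, F n x = u n x := fun n x => rfl
  have hequi : Equicontinuous ((↑) : range F → Icc a b → ℝ) := by
    refine (Metric.uniformEquicontinuous_of_continuity_modulus
      (fun d => (C * d) ^ (1 / 3 : ℝ)) ?_ _ ?_).equicontinuous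
    · have h : ContinuousAt (fun d : ℝ => (C * d) ^ (1 / 3 : ℝ)) 0 :=
        ContinuousAt.rpow_const (by fun_prop) (Or.inr (by norm_num))
      have h0 : (C * 0) ^ (1 / 3 : ℝ) = 0 := by
        rw [mul_zero, Real.zero_rpow (by norm_num)]
      simpa only [ContinuousAt, h0] using h
    · rintro x y ⟨_, n, rfl⟩
      have h := hmod n x y x.2 y.2
      have hd : (|u n x - u n y| ^ 3) ^ (1 / 3 : ℝ) = |u n x - u n y| := by
        rw [← Real.rpow_natCast, ← Real.rpow_mul (abs_nonneg _)]
        norm_num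
      change |u n x - u n y| ≤ (C * |(x : ℝ) - y|) ^ (1 / 3 : ℝ)
      rw [← hd]
      exact Real.rpow_le_rpow (by positivity) h (by norm_num)
  have hcompact := BoundedContinuousFunction.arzela_ascoli (Icc (-R) R) isCompact_Icc (range F)
    (by rintro _ x ⟨n, rfl⟩; exact abs_le.1 (hbound n x x.2)) hequi
  obtain ⟨g, -, φ, hφ, hg⟩ := hcompact.tendsto_subseq (fun n => subset_closure (mem_range_self n))
  refine ⟨IccExtend hab g, g.continuous.Icc_extend', φ, hφ, fun θ hθ => ?_⟩
  rw [IccExtend_of_mem _ _ hθ]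
  exact ((BoundedContinuousFunction.lipschitz_eval_const
    (⟨θ, hθ⟩ : Icc a b)).continuous.tendsto g).comp hg

theorem abs_sub_pow_three_le {p q ε : ℝ} (hε : 0 ≤ ε) :
    |p - q| ^ 3 ≤ 4 * |p ^ 3 + 3 * ε * p - (q ^ 3 + 3 * ε * q)| := by
  have h : p ^ 3 + 3 * ε * p - (q ^ 3 + 3 * ε * q) =
      (p - q) * (p ^ 2 + p * q + q ^ 2 + 3 * ε) := by ring
  have hpos : 0 ≤ p ^ 2 + p * q + q ^ 2 + 3 * ε := by
    nlinarith [sq_nonneg (p + q), sq_nonneg p, sq_nonneg q]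
  rw [h, abs_mul, abs_of_nonneg hpos, pow_succ', sq_abs]
  nlinarith [mul_nonneg (abs_nonneg (p - q)) (sq_nonneg (p + q)),
    mul_nonneg (abs_nonneg (p - q)) hε]

theorem hasDerivAt_regularized_cube {A B u : ℝ → ℝ} {ε θ : ℝ} (hε : 0 < ε)
    (hu : HasDerivAt u (regularizedSlope A B ε θ (u θ)) θ) :
    HasDerivAt (fun θ => u θ ^ 3 + 3 * ε * u θ) (-3 * (B θ * u θ ^ 2 + A θ)) θ := by
  have hpos : u θ ^ 2 + ε ≠ 0 := by positivity
  refine ((hu.pow 3).add (hu.const_mul (3 * ε))).congr_deriv ?_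
  simp only [regularizedSlope]
  field_simp
  push_cast
  ring

/-- The limit `ε → 0` of the antiperiodic solutions of the regularized equation: the equation for
`u` is singular on the equator `u = 0`, but the one for `v = u ^ 3` is not. -/
theorem exists_antiperiodic_profile {A B : ℝ → ℝ} {M a b : ℝ}
    (hAc : Continuous A) (hBc : Continuous B) (hA : ∀ θ, |A θ| ≤ M) (hB : ∀ θ, |B θ| ≤ M)
    (hab : a ≤ b) :
    ∃ u v : ℝ → ℝ, Continuous u ∧ (∀ θ, HasDerivAt v (-3 * (B θ * u θ ^ 2 + A θ)) θ) ∧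
      (∀ θ ∈ Icc a b, v θ = u θ ^ 3) ∧ u b = -u a := by
  have hM : 0 ≤ M := (abs_nonneg _).trans (hA 0)
  choose u hu hub hubound using fun n : ℕ =>
    exists_regularized_solution_antiperiodic (ε := 1 / ((n : ℝ) + 1)) hAc hBc hA hB
      (by positivity) (by rw [div_le_one (by positivity)]; linarith [n.cast_nonneg (α := ℝ)]) hab
  set R := 1 + 2 * ((2 * M + 1) * (b - a)) with hR
  have hcont : ∀ n, Continuous (u n) := fun n =>
    continuous_iff_continuousAt.2 fun θ => (hu n θ).continuousAt
  have hw := fun (n : ℕ) θ => hasDerivAt_regularized_cube (by positivity) (hu n θ)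
  have hslope : ∀ n, ∀ θ ∈ Icc a b, |-3 * (B θ * u n θ ^ 2 + A θ)| ≤ 3 * (M * (R ^ 2 + 1)) := by
    intro n θ hθ
    rw [abs_mul, abs_neg, abs_of_pos (by norm_num : (0 : ℝ) < 3)]
    have h2 : u n θ ^ 2 ≤ R ^ 2 := sq_le_sq' (abs_le.1 (hubound n θ hθ)).1
      (abs_le.1 (hubound n θ hθ)).2
    have := abs_mul_sq_add_le (hB θ) (hA θ) (u n θ)
    nlinarith
  have hmod : ∀ n, ∀ x y, x ∈ Icc a b → y ∈ Icc a b →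
      |u n x - u n y| ^ 3 ≤ 4 * (3 * (M * (R ^ 2 + 1))) * |x - y| := by
    intro n x y hx hy
    have := (convex_Icc a b).norm_image_sub_le_of_norm_hasDerivWithin_le
      (fun θ _ => (hw n θ).hasDerivWithinAt) (hslope n) hy hx
    rw [mul_assoc]
    exact (abs_sub_pow_three_le (by positivity)).trans (mul_le_mul_of_nonneg_left this (by norm_num))
  obtain ⟨g, hg, φ, hφ, hlim⟩ := exists_subseq_tendsto_of_cube_modulus hab u hcont hubound hmod
  have hint : Continuous fun θ => -3 * (B θ * g θ ^ 2 + A θ) := by fun_prop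
  refine ⟨g, fun θ => g a ^ 3 + ∫ t in a..θ, -3 * (B t * g t ^ 2 + A t), hg, fun θ => ?_,
    fun θ hθ => ?_, ?_⟩
  · exact (intervalIntegral.integral_hasDerivAt_right (hint.intervalIntegrable _ _)
      (hint.stronglyMeasurableAtFilter _ _) hint.continuousAt).const_add _
  · have hεlim : Tendsto (fun n => 3 * (1 / ((φ n : ℝ) + 1))) atTop (𝓝 0) := by
      simpa using ((tendsto_one_div_add_atTop_nhds_zero_nat (𝕜 := ℝ)).comp
        hφ.tendsto_atTop).const_mul 3
    have hwlim : ∀ θ ∈ Icc a b, Tendsto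
        (fun n => u (φ n) θ ^ 3 + 3 * (1 / ((φ n : ℝ) + 1)) * u (φ n) θ) atTop (𝓝 (g θ ^ 3)) := by
      intro θ hθ
      simpa using ((hlim θ hθ).pow 3).add (hεlim.mul (hlim θ hθ))
    have hsub : uIoc a θ ⊆ Icc a b := by
      rw [uIoc_of_le hθ.1]
      exact fun t ht => ⟨ht.1.le, ht.2.trans hθ.2⟩
    have hI : Tendsto (fun n => ∫ t in a..θ, -3 * (B t * u (φ n) t ^ 2 + A t)) atTop
        (𝓝 (∫ t in a..θ, -3 * (B t * g t ^ 2 + A t))) := by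
      refine intervalIntegral.tendsto_integral_filter_of_dominated_convergence
        (fun _ => 3 * (M * (R ^ 2 + 1))) (Eventually.of_forall fun n => ?_)
        (Eventually.of_forall fun n => Eventually.of_forall fun t ht => hslope _ t (hsub ht))
        intervalIntegrable_const (Eventually.of_forall fun t ht => ?_)
      · have := hcont (φ n)
        exact Continuous.aestronglyMeasurable (by fun_prop)
      · exact ((((hlim t (hsub ht)).pow 2).const_mul (B t)).add_const (A t)).const_mul (-3)
    have heq : ∀ n, ∫ t in a..θ, -3 * (B t * u (φ n) t ^ 2 + A t) =
        u (φ n) θ ^ 3 + 3 * (1 / ((φ n : ℝ) + 1)) * u (φ n) θ -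
          (u (φ n) a ^ 3 + 3 * (1 / ((φ n : ℝ) + 1)) * u (φ n) a) := by
      intro n
      have := hcont (φ n)
      exact intervalIntegral.integral_eq_sub_of_hasDerivAt (fun t _ => hw (φ n) t)
        (Continuous.intervalIntegrable (by fun_prop) _ _)
    simp_rw [heq] at hI
    have := tendsto_nhds_unique hI ((hwlim θ hθ).sub (hwlim a (left_mem_Icc.2 hab)))
    simp only [this]
    ring
  · refine tendsto_nhds_unique (hlim b (right_mem_Icc.2 hab)) ?_
    simp_rw [hub]
    exact (hlim a (left_mem_Icc.2 hab)).neg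

theorem not_pos_of_profile_zero_left {A B u v : ℝ → ℝ} {a c k M : ℝ} (hac : a < c) (hk : 0 < k)
    (hB : ∀ θ, |B θ| ≤ M) (hA : ∀ θ ∈ Icc a c, k * (θ - a) ≤ A θ) (hu : Continuous u)
    (hv : ∀ θ, HasDerivAt v (-3 * (B θ * u θ ^ 2 + A θ)) θ)
    (hvu : ∀ θ ∈ Icc a c, v θ = u θ ^ 3) (ha : u a = 0) : ¬ ∀ θ ∈ Ioo a c, 0 < u θ := by
  intro hpos
  have hM : 0 ≤ M := (abs_nonneg _).trans (hB 0)
  have hden : 0 < 18 * M ^ 3 + 1 := by positivity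
  set δ := min ((c - a) / 2) (k / (18 * M ^ 3 + 1)) with hδ
  have hδ0 : 0 < δ := lt_min (by linarith) (by positivity)
  have hδc : a + δ < c := by linarith [min_le_left ((c - a) / 2) (k / (18 * M ^ 3 + 1))]
  have hδk : 18 * M ^ 3 * δ < k := by
    have h : δ * (18 * M ^ 3 + 1) ≤ k := (le_div_iff₀ hden).1 (min_le_right _ _)
    linarith
  obtain ⟨s, hs, hmax⟩ := (isCompact_Icc (a := a) (b := a + δ)).exists_isMaxOn
    (nonempty_Icc.2 (by linarith)) hu.continuousOn
  have hus : 0 < u s :=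
    (hpos (a + δ) ⟨by linarith, hδc⟩).trans_le (hmax (right_mem_Icc.2 (by linarith)))
  have has : a < s := lt_of_le_of_ne hs.1 fun h => by rw [← h, ha] at hus; exact hus.false
  have hsq : ∀ θ ∈ Icc a s, B θ * u θ ^ 2 ≥ -(M * u s ^ 2) := by
    intro θ hθ
    have h0 : 0 ≤ u θ := by
      rcases hθ.1.eq_or_lt with h | h
      · rw [← h, ha]
      · exact (hpos θ ⟨h, by linarith [hθ.2, hs.2]⟩).le
    have h1 : u θ ≤ u s := hmax ⟨hθ.1, hθ.2.trans hs.2⟩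
    have h2 : u θ ^ 2 ≤ u s ^ 2 := pow_le_pow_left₀ h0 h1 2
    nlinarith [(abs_le.1 (hB θ)).1, sq_nonneg (u θ)]
  have hvs : v s = u s ^ 3 := hvu s ⟨hs.1, by linarith [hs.2]⟩
  have hva : v a = 0 := by rw [hvu a (left_mem_Icc.2 hac.le), ha]; norm_num
  have hAs : ∀ θ ∈ Icc a s, k * (θ - a) ≤ A θ := fun θ hθ =>
    hA θ ⟨hθ.1, by linarith [hθ.2, hs.2]⟩
  have hanti : AntitoneOn
      (fun θ => v θ - 3 * (M * u s ^ 2) * (θ - a) + 3 / 2 * k * (θ - a) ^ 2) (Icc a s) := by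
    have hd : ∀ θ, HasDerivAt
        (fun θ => v θ - 3 * (M * u s ^ 2) * (θ - a) + 3 / 2 * k * (θ - a) ^ 2)
        (-3 * (B θ * u θ ^ 2 + A θ) - 3 * (M * u s ^ 2) + 3 * k * (θ - a)) θ := fun θ =>
      (((hv θ).sub (((hasDerivAt_id θ).sub_const a).const_mul (3 * (M * u s ^ 2)))).add
        ((((hasDerivAt_id θ).sub_const a).pow 2).const_mul (3 / 2 * k))).congr_deriv
        (by simp only [id]; push_cast; ring)
    refine antitoneOn_of_deriv_nonpos (convex_Icc a s)
      (fun θ _ => (hd θ).continuousAt.continuousWithinAt)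
      (fun θ _ => (hd θ).differentiableAt.differentiableWithinAt) fun θ hθ => ?_
    rw [interior_Icc] at hθ
    rw [(hd θ).deriv]
    have := hsq θ (Ioo_subset_Icc_self hθ)
    have := hAs θ (Ioo_subset_Icc_self hθ)
    linarith
  have h := hanti (left_mem_Icc.2 has.le) (right_mem_Icc.2 has.le) has.le
  simp only [hva, hvs, sub_self, mul_zero] at h
  have hσ : 0 < s - a := by linarith
  have hσδ : s - a ≤ δ := by linarith [hs.2]
  have hlin : u s ≤ 3 * M * (s - a) := by
    have h2 : 0 < u s ^ 2 := by positivity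
    have h3 : u s ^ 2 * u s ≤ u s ^ 2 * (3 * M * (s - a)) := by
      nlinarith [mul_nonneg hk.le (sq_nonneg (s - a))]
    exact le_of_mul_le_mul_left h3 h2
  have hsq' : u s ^ 2 ≤ (3 * M * (s - a)) ^ 2 := pow_le_pow_left₀ hus.le hlin 2
  have h4 : 18 * M ^ 3 * (s - a) < k :=
    (mul_le_mul_of_nonneg_left hσδ (by positivity)).trans_lt hδk
  have h5 : 3 * (M * u s ^ 2) * (s - a) ≤ 3 * (M * (3 * M * (s - a)) ^ 2) * (s - a) := by gcongr
  have h6 : 0 < (s - a) ^ 2 * (k - 18 * M ^ 3 * (s - a)) := by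
    have := sub_pos.2 h4
    positivity
  have h7 : 0 < u s ^ 3 := by positivity
  nlinarith

theorem pos_left_of_profile_nonneg {A B u v : ℝ → ℝ} {a c : ℝ}
    (hA : ∀ θ ∈ Ioc a c, 0 < A θ) (hv : ∀ θ, HasDerivAt v (-3 * (B θ * u θ ^ 2 + A θ)) θ)
    (hvu : ∀ θ ∈ Icc a c, v θ = u θ ^ 3) (hc : 0 ≤ v c) : ∀ θ ∈ Ioo a c, 0 < v θ := by
  intro x hx
  by_contra! hvx
  have hneg : ∀ θ ∈ Ioc a c, v θ = 0 → -3 * (B θ * u θ ^ 2 + A θ) < 0 := by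
    intro θ hθ h
    have hu0 : u θ = 0 := by
      rw [hvu θ (Ioc_subset_Icc_self hθ)] at h
      exact pow_eq_zero_iff (by norm_num) |>.1 h
    rw [hu0]
    linarith [hA θ hθ]
  have hle : ∀ θ ∈ Icc x c, v θ ≤ 0 :=
    image_le_of_deriv_right_lt_deriv_boundary' (B := fun _ => 0) (B' := fun _ => 0)
      (fun θ _ => (hv θ).continuousAt.continuousWithinAt) (fun θ _ => (hv θ).hasDerivWithinAt)
      hvx continuousOn_const (fun θ _ => (hasDerivAt_const θ _).hasDerivWithinAt)
      fun θ hθ h => hneg θ ⟨hx.1.trans_le hθ.1, hθ.2.le⟩ h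
  have hc0 : v c = 0 := le_antisymm (hle c (right_mem_Icc.2 hx.2.le)) hc
  have hslope : Tendsto (slope v c) (𝓝[<] c) (𝓝 (-3 * (B c * u c ^ 2 + A c))) :=
    (hasDerivAt_iff_tendsto_slope.1 (hv c)).mono_left
      (nhdsWithin_mono _ fun y hy => ne_of_lt hy)
  have : 0 ≤ -3 * (B c * u c ^ 2 + A c) := by
    refine ge_of_tendsto hslope ?_
    filter_upwards [Ioo_mem_nhdsLT hx.2] with y hy
    rw [slope_def_field, hc0, sub_zero]
    exact div_nonneg_of_nonpos (hle y ⟨hy.1.le, hy.2.le⟩) (by linarith [hy.2])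
  exact this.not_gt (hneg c (right_mem_Ioc.2 (hx.1.trans hx.2)) hc0)

theorem profile_neg_of_zero_left {A B u v : ℝ → ℝ} {a c k M : ℝ} (hac : a < c) (hk : 0 < k)
    (hB : ∀ θ, |B θ| ≤ M) (hA : ∀ θ ∈ Icc a c, k * (θ - a) ≤ A θ) (hu : Continuous u)
    (hv : ∀ θ, HasDerivAt v (-3 * (B θ * u θ ^ 2 + A θ)) θ)
    (hvu : ∀ θ ∈ Icc a c, v θ = u θ ^ 3) (ha : u a = 0) : v c < 0 := by
  by_contra! hc
  refine not_pos_of_profile_zero_left hac hk hB hA hu hv hvu ha fun θ hθ => ?_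
  have hApos : ∀ θ ∈ Ioc a c, 0 < A θ := fun θ hθ =>
    (mul_pos hk (sub_pos.2 hθ.1)).trans_le (hA θ (Ioc_subset_Icc_self hθ))
  have := pos_left_of_profile_nonneg hApos hv hvu hc θ hθ
  rw [hvu θ (Ioo_subset_Icc_self hθ)] at this
  exact (Odd.pow_pos_iff (by decide)).1 this

theorem profile_ne_zero_of_antiperiodic {A B u v : ℝ → ℝ} {a b k M : ℝ} (hab : a < b) (hk : 0 < k)
    (hB : ∀ θ, |B θ| ≤ M) (hAl : ∀ θ ∈ Icc a ((a + b) / 2), k * (θ - a) ≤ A θ)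
    (hAr : ∀ θ ∈ Icc ((a + b) / 2) b, k * (b - θ) ≤ A θ) (hu : Continuous u)
    (hv : ∀ θ, HasDerivAt v (-3 * (B θ * u θ ^ 2 + A θ)) θ)
    (hvu : ∀ θ ∈ Icc a b, v θ = u θ ^ 3) (hanti : u b = -u a) : u a ≠ 0 := by
  intro ha
  set m := (a + b) / 2 with hm
  have h1 : v m < 0 := profile_neg_of_zero_left (by linarith) hk hB hAl hu hv
    (fun θ hθ => hvu θ ⟨hθ.1, by linarith [hθ.2]⟩) ha
  have h2 : -v (a + b - m) < 0 := by
    refine profile_neg_of_zero_left (A := fun θ => A (a + b - θ)) (B := fun θ => B (a + b - θ))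
      (u := fun θ => -u (a + b - θ)) (v := fun θ => -v (a + b - θ)) (a := a) (M := M)
      (by linarith) hk (fun θ => hB _) (fun θ hθ => ?_) (by fun_prop) (fun θ => ?_)
      (fun θ hθ => ?_) ?_
    · have := hAr (a + b - θ) ⟨by linarith [hθ.2], by linarith [hθ.1]⟩
      linarith
    · exact ((hv (a + b - θ)).comp θ ((hasDerivAt_id θ).const_sub (a + b))).neg.congr_deriv
        (by ring)
    · have := hvu (a + b - θ) ⟨by linarith [hθ.2], by linarith [hθ.1]⟩
      rw [this]
      ring
    · simp [hanti, ha]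
  have h3 : a + b - m = m := by linarith
  rw [h3] at h2
  linarith

/-- The vector field of `(S)` in the coordinates longitude `θ` and `u = cot φ`, with `φ` the
colatitude, where `A` and `B` collect the cubic and the linear terms. -/
noncomputable def cylinderField (A B : ℝ → ℝ) (p : ℝ × ℝ) : ℝ × ℝ :=
  (p.2 ^ 2 / (1 + p.2 ^ 2), -(B p.1 * p.2 ^ 2 + A p.1) / (1 + p.2 ^ 2))

theorem norm_cylinderField_le {A B : ℝ → ℝ} {M : ℝ} (hA : ∀ θ, |A θ| ≤ M)
    (hB : ∀ θ, |B θ| ≤ M) (p : ℝ × ℝ) : ‖cylinderField A B p‖ ≤ 1 + M := by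
  have hM : 0 ≤ M := (abs_nonneg _).trans (hA 0)
  have hpos : 0 < 1 + p.2 ^ 2 := by positivity
  refine max_le ?_ ?_
  · change |p.2 ^ 2 / (1 + p.2 ^ 2)| ≤ _
    rw [abs_of_nonneg (by positivity), div_le_iff₀ hpos]
    nlinarith [sq_nonneg p.2]
  · change |-(B p.1 * p.2 ^ 2 + A p.1) / (1 + p.2 ^ 2)| ≤ _
    rw [abs_div, abs_neg, abs_of_pos hpos, div_le_iff₀ hpos]
    have := abs_mul_sq_add_le (hB p.1) (hA p.1) p.2
    nlinarith

theorem abs_sq_div_one_add_sq_sub_le (u w : ℝ) :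
    |u ^ 2 / (1 + u ^ 2) - w ^ 2 / (1 + w ^ 2)| ≤ |u - w| := by
  have hu : 0 < 1 + u ^ 2 := by positivity
  have hw : 0 < 1 + w ^ 2 := by positivity
  have h : u ^ 2 / (1 + u ^ 2) - w ^ 2 / (1 + w ^ 2) =
      (u + w) / ((1 + u ^ 2) * (1 + w ^ 2)) * (u - w) := by
    field_simp
    ring
  rw [h, abs_mul]
  refine mul_le_of_le_one_left (abs_nonneg _) ?_
  rw [abs_div, abs_of_pos (mul_pos hu hw), div_le_one (mul_pos hu hw), abs_le]
  constructor <;> nlinarith [sq_nonneg (u + 1), sq_nonneg (w + 1), sq_nonneg (u - 1),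
    sq_nonneg (w - 1), mul_nonneg (sq_nonneg u) (sq_nonneg w)]

theorem cylinderField_lipschitz {A B : ℝ → ℝ} {M KA KB : ℝ} (hA : ∀ θ, |A θ| ≤ M)
    (hB : ∀ θ, |B θ| ≤ M) (hKA : 0 ≤ KA) (hKB : 0 ≤ KB)
    (hAl : ∀ x y, |A x - A y| ≤ KA * |x - y|) (hBl : ∀ x y, |B x - B y| ≤ KB * |x - y|) :
    ∃ K : ℝ≥0, LipschitzWith K (cylinderField A B) := by
  have hM : 0 ≤ M := (abs_nonneg _).trans (hA 0)
  refine ⟨⟨1 + 2 * M + KA + KB, by positivity⟩, LipschitzWith.of_dist_le_mul ?_⟩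
  rintro ⟨x, u⟩ ⟨y, w⟩
  change dist _ _ ≤ (1 + 2 * M + KA + KB) * _
  set d := dist (x, u) (y, w) with hd
  have hx : |x - y| ≤ d := le_max_left _ _
  have hu : |u - w| ≤ d := le_max_right _ _
  have hd0 : 0 ≤ d := dist_nonneg
  have hp := (abs_sq_div_one_add_sq_sub_le u w).trans hu
  have hsecond : ∀ θ t, -(B θ * t ^ 2 + A θ) / (1 + t ^ 2) =
      -(B θ * (t ^ 2 / (1 + t ^ 2)) + A θ * (1 - t ^ 2 / (1 + t ^ 2))) := by
    intro θ t
    have : 1 + t ^ 2 ≠ 0 := by positivity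
    field_simp
    ring
  have hrange : ∀ t : ℝ, 0 ≤ t ^ 2 / (1 + t ^ 2) ∧ t ^ 2 / (1 + t ^ 2) ≤ 1 := by
    intro t
    refine ⟨by positivity, ?_⟩
    rw [div_le_one (by positivity)]
    linarith
  refine max_le ?_ ?_
  · change |u ^ 2 / (1 + u ^ 2) - w ^ 2 / (1 + w ^ 2)| ≤ _
    refine hp.trans (le_mul_of_one_le_left hd0 ?_)
    linarith
  · change |-(B x * u ^ 2 + A x) / (1 + u ^ 2) - -(B y * w ^ 2 + A y) / (1 + w ^ 2)| ≤ _
    rw [hsecond, hsecond]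
    obtain ⟨hu0, hu1⟩ := hrange u
    set p := u ^ 2 / (1 + u ^ 2)
    set q := w ^ 2 / (1 + w ^ 2)
    have h1 : |(B x - B y) * p| ≤ KB * d := by
      rw [abs_mul, abs_of_nonneg hu0]
      exact (mul_le_of_le_one_right (abs_nonneg _) hu1).trans
        ((hBl x y).trans (mul_le_mul_of_nonneg_left hx hKB))
    have h2 : |(A x - A y) * (1 - p)| ≤ KA * d := by
      rw [abs_mul, abs_of_nonneg (sub_nonneg.2 hu1)]
      exact (mul_le_of_le_one_right (abs_nonneg _) (by linarith)).trans
        ((hAl x y).trans (mul_le_mul_of_nonneg_left hx hKA))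
    have h3 : |B y * (p - q)| ≤ M * d := by
      rw [abs_mul]
      exact mul_le_mul (hB y) hp (abs_nonneg _) hM
    have h4 : |A y * (p - q)| ≤ M * d := by
      rw [abs_mul]
      exact mul_le_mul (hA y) hp (abs_nonneg _) hM
    rw [abs_le] at *
    constructor <;> nlinarith

theorem deriv_limit_eq_zero {f f' : ℝ → ℝ} {l l' : ℝ} (hf : ∀ t, HasDerivAt f (f' t) t)
    (hl : Tendsto f atTop (𝓝 l)) (hl' : Tendsto f' atTop (𝓝 l')) : l' = 0 := by
  have hmvt : ∀ n : ℕ, ∃ ξ ∈ Ioo (n : ℝ) (n + 1), f' ξ = f (n + 1) - f n := by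
    intro n
    obtain ⟨ξ, hξ, h⟩ := exists_hasDerivAt_eq_slope f f' (lt_add_one (n : ℝ))
      (fun t _ => (hf t).continuousAt.continuousWithinAt) fun t _ => hf t
    exact ⟨ξ, hξ, by simpa using h⟩
  choose ξ hξ hξ' using hmvt
  have hξlim : Tendsto ξ atTop atTop :=
    tendsto_atTop_mono (fun n => (hξ n).1.le) tendsto_natCast_atTop_atTop
  have h1 := hl'.comp hξlim
  have h2 : Tendsto (fun n : ℕ => f (n + 1) - f n) atTop (𝓝 (l - l)) :=
    (hl.comp (tendsto_atTop_add_const_right _ _ tendsto_natCast_atTop_atTop)).sub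
      (hl.comp tendsto_natCast_atTop_atTop)
  rw [sub_self] at h2
  exact tendsto_nhds_unique (h1.congr fun n => hξ' n) h2

theorem abs_sq_mul_sub_sq_le {p q S : ℝ} (hS : |p + q| ≤ S) :
    3 * |p ^ 2 * (q ^ 2 - p ^ 2)| ≤ 4 * S * |p ^ 3 - q ^ 3| := by
  have h1 : p ^ 3 - q ^ 3 = (p - q) * (p ^ 2 + p * q + q ^ 2) := by ring
  have h2 : p ^ 2 * (q ^ 2 - p ^ 2) = -(p ^ 2 * ((p + q) * (p - q))) := by ring
  have hpos : 0 ≤ p ^ 2 + p * q + q ^ 2 := by nlinarith [sq_nonneg (p + q), sq_nonneg (p - q)]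
  have h3 : 3 * p ^ 2 ≤ 4 * (p ^ 2 + p * q + q ^ 2) := by nlinarith [sq_nonneg (p + 2 * q)]
  rw [h1, h2, abs_neg, abs_mul, abs_mul, abs_mul, abs_of_nonneg hpos, abs_of_nonneg (sq_nonneg p)]
  have hS0 : 0 ≤ S := (abs_nonneg _).trans hS
  calc 3 * (p ^ 2 * (|p + q| * |p - q|)) = |p + q| * |p - q| * (3 * p ^ 2) := by ring
    _ ≤ S * |p - q| * (4 * (p ^ 2 + p * q + q ^ 2)) := by gcongr
    _ = _ := by ring

/-- Solutions of the cylinder system that start on the graph of a profile stay on it. -/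
theorem eq_profile_of_cylinder_solution {A B u v Θ U : ℝ → ℝ} {a b M T : ℝ}
    (hB : ∀ θ, |B θ| ≤ M) (hu : Continuous u)
    (hv : ∀ θ, HasDerivAt v (-3 * (B θ * u θ ^ 2 + A θ)) θ)
    (hvu : ∀ θ ∈ Icc a b, v θ = u θ ^ 3)
    (hΘ : ∀ t, HasDerivAt Θ (U t ^ 2 / (1 + U t ^ 2)) t)
    (hU : ∀ t, HasDerivAt U (-(B (Θ t) * U t ^ 2 + A (Θ t)) / (1 + U t ^ 2)) t)
    (h0 : U 0 = u (Θ 0)) (hT : 0 ≤ T) (hmem : ∀ t ∈ Icc 0 T, Θ t ∈ Icc a b) :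
    U T = u (Θ T) := by
  have hM : 0 ≤ M := (abs_nonneg _).trans (hB 0)
  have hΘc : Continuous Θ := continuous_iff_continuousAt.2 fun t => (hΘ t).continuousAt
  have hUc : Continuous U := continuous_iff_continuousAt.2 fun t => (hU t).continuousAt
  obtain ⟨S, hS⟩ := (isCompact_Icc (a := (0 : ℝ)) (b := T)).exists_bound_of_continuousOn
    (f := fun t => U t + u (Θ t)) (by fun_prop)
  have hderiv : ∀ t, HasDerivAt (fun t => U t ^ 3 - v (Θ t))
      (3 * B (Θ t) * (U t ^ 2 * (u (Θ t) ^ 2 - U t ^ 2)) / (1 + U t ^ 2)) t := by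
    intro t
    have hpos : 1 + U t ^ 2 ≠ 0 := by positivity
    refine (((hU t).pow 3).sub ((hv (Θ t)).comp t (hΘ t))).congr_deriv ?_
    field_simp
    push_cast
    ring
  have hzero := eq_zero_of_abs_deriv_le_mul_abs_self_of_eq_zero_right (K := M * (4 * S))
    (a := 0) (b := T) (fun t _ => (hderiv t).continuousAt.continuousWithinAt)
    (fun t _ => (hderiv t).hasDerivWithinAt)
    (by rw [hvu _ (hmem 0 (left_mem_Icc.2 hT)), h0, sub_self]) (fun t ht => ?_)
    T (right_mem_Icc.2 hT)
  · rw [hvu _ (hmem T (right_mem_Icc.2 hT)), sub_eq_zero] at hzero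
    exact (Odd.strictMono_pow (by decide)).injective hzero
  · have ht' := Ico_subset_Icc_self ht
    have hpos : 0 < 1 + U t ^ 2 := by positivity
    rw [Real.norm_eq_abs, Real.norm_eq_abs, hvu _ (hmem t ht'), abs_div, abs_of_pos hpos]
    refine (div_le_self (abs_nonneg _) (by nlinarith [sq_nonneg (U t)])).trans ?_
    have h1 := abs_sq_mul_sub_sq_le (hS t ht')
    rw [abs_mul, abs_mul, abs_of_pos (by norm_num : (0 : ℝ) < 3)]
    calc 3 * |B (Θ t)| * |U t ^ 2 * (u (Θ t) ^ 2 - U t ^ 2)|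
        = |B (Θ t)| * (3 * |U t ^ 2 * (u (Θ t) ^ 2 - U t ^ 2)|) := by ring
      _ ≤ M * (4 * S * |U t ^ 3 - u (Θ t) ^ 3|) :=
        mul_le_mul (hB _) h1 (by positivity) hM
      _ = _ := by ring

theorem exists_cylinder_solution_reaches {A B u v Θ U : ℝ → ℝ} {a b M : ℝ} (hab : a < b)
    (hAc : Continuous A) (hBc : Continuous B) (hB : ∀ θ, |B θ| ≤ M) (hu : Continuous u)
    (hv : ∀ θ, HasDerivAt v (-3 * (B θ * u θ ^ 2 + A θ)) θ)
    (hvu : ∀ θ ∈ Icc a b, v θ = u θ ^ 3) (hnz : ∀ θ ∈ Icc a b, u θ = 0 → A θ ≠ 0)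
    (hΘ : ∀ t, HasDerivAt Θ (U t ^ 2 / (1 + U t ^ 2)) t)
    (hU : ∀ t, HasDerivAt U (-(B (Θ t) * U t ^ 2 + A (Θ t)) / (1 + U t ^ 2)) t)
    (hΘ0 : Θ 0 = a) (hU0 : U 0 = u a) :
    ∃ T > 0, Θ T = b ∧ ∀ t ∈ Icc 0 T, Θ t ∈ Icc a b ∧ U t = u (Θ t) := by
  have hmono : Monotone Θ := monotone_of_hasDerivAt_nonneg hΘ fun t => by
    change 0 ≤ U t ^ 2 / (1 + U t ^ 2)
    positivity
  have hΘc : Continuous Θ := continuous_iff_continuousAt.2 fun t => (hΘ t).continuousAt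
  have hgraph : ∀ T, 0 ≤ T → Θ T ≤ b → ∀ t ∈ Icc 0 T, Θ t ∈ Icc a b ∧ U t = u (Θ t) := by
    intro T _ hTb t ht
    have hmem : ∀ s ∈ Icc 0 T, Θ s ∈ Icc a b := fun s hs =>
      ⟨hΘ0 ▸ hmono hs.1, (hmono hs.2).trans hTb⟩
    exact ⟨hmem t ht, eq_profile_of_cylinder_solution hB hu hv hvu hΘ hU (by rw [hΘ0, hU0]) ht.1
      fun s hs => hmem s ⟨hs.1, hs.2.trans ht.2⟩⟩
  by_cases hex : ∃ t, b ≤ Θ t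
  · obtain ⟨t, ht⟩ := hex
    have ht0 : 0 ≤ t := by
      by_contra! h
      have := hmono h.le
      linarith
    obtain ⟨T, hT, hTb⟩ := intermediate_value_Icc ht0 hΘc.continuousOn
      (⟨by linarith, ht⟩ : b ∈ Icc (Θ 0) (Θ t))
    refine ⟨T, lt_of_le_of_ne hT.1 fun h => ?_, hTb, hgraph T hT.1 hTb.le⟩
    rw [← h] at hTb
    linarith
  · exfalso
    push Not at hex
    have hbdd : BddAbove (range Θ) := ⟨b, by rintro _ ⟨t, rfl⟩; exact (hex t).le⟩
    have hlim := tendsto_atTop_ciSup hmono hbdd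
    set l := ⨆ t, Θ t
    have hl : l ∈ Icc a b := ⟨hΘ0 ▸ le_ciSup hbdd 0, ciSup_le fun t => (hex t).le⟩
    have hUlim : Tendsto U atTop (𝓝 (u l)) := by
      refine ((hu.tendsto l).comp hlim).congr' ?_
      filter_upwards [eventually_ge_atTop 0] with t ht
      exact (hgraph t ht (hex t).le t (right_mem_Icc.2 ht)).2.symm
    have hden : Tendsto (fun t => 1 + U t ^ 2) atTop (𝓝 (1 + u l ^ 2)) :=
      (hUlim.pow 2).const_add 1
    have hden0 : 1 + u l ^ 2 ≠ 0 := by positivity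
    have h1 := deriv_limit_eq_zero hΘ hlim ((hUlim.pow 2).div hden hden0)
    have h2 := deriv_limit_eq_zero hU hUlim
      ((((((hBc.tendsto l).comp hlim).mul (hUlim.pow 2)).add
        ((hAc.tendsto l).comp hlim)).neg).div hden hden0)
    have hul : u l = 0 := by simpa [hden0] using h1
    refine hnz l hl hul ?_
    simpa [hul] using h2

theorem exists_antiperiodic_cylinder_solution {A B u v : ℝ → ℝ} {a c : ℝ} (hc : 0 < c)
    (hA : ContDiff ℝ 1 A) (hB : ContDiff ℝ 1 B) (hAp : Function.Antiperiodic A c)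
    (hBp : Function.Antiperiodic B c) (hu : Continuous u)
    (hv : ∀ θ, HasDerivAt v (-3 * (B θ * u θ ^ 2 + A θ)) θ)
    (hvu : ∀ θ ∈ Icc a (a + c), v θ = u θ ^ 3) (hanti : u (a + c) = -u a)
    (hnz : ∀ θ ∈ Icc a (a + c), u θ = 0 → A θ ≠ 0) :
    ∃ T > 0, ∃ Θ U : ℝ → ℝ,
      (∀ t, HasDerivAt Θ (U t ^ 2 / (1 + U t ^ 2)) t) ∧
      (∀ t, HasDerivAt U (-(B (Θ t) * U t ^ 2 + A (Θ t)) / (1 + U t ^ 2)) t) ∧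
      (∀ t, Θ (t + T) = Θ t + c) ∧ (∀ t, U (t + T) = -U t) ∧ ∃ t, U t = 0 ∧ A (Θ t) ≠ 0 := by
  have hc2 : 0 < 2 * c := by linarith
  obtain ⟨MA, hMA⟩ := hAp.periodic_two_mul.exists_abs_le hc2 hA.continuous
  obtain ⟨MB, hMB⟩ := hBp.periodic_two_mul.exists_abs_le hc2 hB.continuous
  obtain ⟨KA, hKA, hAl⟩ := hAp.periodic_two_mul.exists_lipschitz hc2 hA
  obtain ⟨KB, hKB, hBl⟩ := hBp.periodic_two_mul.exists_lipschitz hc2 hB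
  have hMA' : ∀ θ, |A θ| ≤ max MA MB := fun θ => (hMA θ).trans (le_max_left _ _)
  have hMB' : ∀ θ, |B θ| ≤ max MA MB := fun θ => (hMB θ).trans (le_max_right _ _)
  obtain ⟨K, hK⟩ := cylinderField_lipschitz hMA' hMB' hKA hKB hAl hBl
  have hM : 0 ≤ max MA MB := (abs_nonneg _).trans (hMA' 0)
  obtain ⟨α, hα0, hα⟩ := exists_hasDerivAt_of_bounded_lipschitz
    (f := fun _ => cylinderField A B) (L := ⟨1 + max MA MB, by positivity⟩) (fun _ => hK)
    (fun _ => continuous_const) (fun _ p => norm_cylinderField_le hMA' hMB' p) 0 (a, u a)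
  have hΘ : ∀ t, HasDerivAt (fun t => (α t).1) ((α t).2 ^ 2 / (1 + (α t).2 ^ 2)) t :=
    fun t => (hα t).fst
  have hU : ∀ t, HasDerivAt (fun t => (α t).2)
      (-(B (α t).1 * (α t).2 ^ 2 + A (α t).1) / (1 + (α t).2 ^ 2)) t := fun t => (hα t).snd
  obtain ⟨T, hT, hTb, hgraph⟩ := exists_cylinder_solution_reaches (by linarith) hA.continuous
    hB.continuous hMB hu hv hvu hnz hΘ hU (by rw [hα0]) (by rw [hα0])
  have hUT : (α T).2 = -u a := by
    rw [(hgraph T (right_mem_Icc.2 hT.le)).2, hTb, hanti]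
  have hshift : (fun t => ((α (t + T)).1 - c, -(α (t + T)).2)) = α := by
    refine ODE_solution_unique_univ (v := fun _ => cylinderField A B) (s := fun _ => univ)
      (K := K) (t₀ := 0) (fun _ => hK.lipschitzOnWith) (fun t => ⟨?_, trivial⟩)
      (fun t => ⟨hα t, trivial⟩) ?_
    · refine ((((hΘ (t + T)).comp_add_const t T).sub_const c).prodMk
        ((hU (t + T)).comp_add_const t T).neg).congr_deriv ?_
      simp only [cylinderField, hAp.sub_eq, hBp.sub_eq, neg_sq]
      congr 1
      ring
    · simp [hTb, hUT, hα0]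
  have hshift' : ∀ t, (α (t + T)).1 - c = (α t).1 ∧ -(α (t + T)).2 = (α t).2 := fun t =>
    Prod.ext_iff.1 (congrFun hshift t)
  refine ⟨T, hT, fun t => (α t).1, fun t => (α t).2, hΘ, hU, fun t => ?_, fun t => ?_, ?_⟩
  · linarith [(hshift' t).1]
  · linarith [(hshift' t).2]
  · have hUc : Continuous fun t => (α t).2 :=
      continuous_iff_continuousAt.2 fun t => (hU t).continuousAt
    obtain ⟨t, ht, ht0⟩ : (0 : ℝ) ∈ (fun t => (α t).2) '' uIcc 0 T := by
      refine intermediate_value_uIcc hUc.continuousOn ?_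
      rw [hUT, hα0, mem_uIcc]
      rcases le_total (u a) 0 with h | h
      · exact Or.inl ⟨h, by linarith⟩
      · exact Or.inr ⟨by linarith, h⟩
    rw [uIcc_of_le hT.le] at ht
    exact ⟨t, ht0, hnz _ (hgraph t ht).1 (by rw [← (hgraph t ht).2]; exact ht0)⟩

theorem two_div_pi_mul_le_cos_left {θ : ℝ} (h1 : -(π / 2) ≤ θ) (h2 : θ ≤ 0) :
    2 / π * (θ + π / 2) ≤ cos θ := by
  rw [← Real.sin_add_pi_div_two]
  exact Real.mul_le_sin (by linarith) (by linarith)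

theorem two_div_pi_mul_le_cos_right {θ : ℝ} (h1 : 0 ≤ θ) (h2 : θ ≤ π / 2) :
    2 / π * (π / 2 - θ) ≤ cos θ := by
  rw [← Real.sin_pi_div_two_sub]
  exact Real.mul_le_sin (by linarith) (by linarith)

theorem quadratic_trig_lower_bound {a1 a2 a3 : ℝ} (hD : a2 ^ 2 - 4 * a1 * a3 < 0)
    (ha1 : 0 < a1) : ∃ q > 0, ∀ θ : ℝ,
      q ≤ a1 * cos θ ^ 2 + a2 * cos θ * sin θ + a3 * sin θ ^ 2 := by
  have ha3 : 0 < a3 := by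
    by_contra! h
    nlinarith [sq_nonneg a2, mul_nonneg ha1.le (neg_nonneg.2 h)]
  refine ⟨(a1 * a3 - a2 ^ 2 / 4) / (a1 + a3), div_pos (by linarith) (by linarith), fun θ => ?_⟩
  rw [div_le_iff₀ (by linarith)]
  have h := sin_sq_add_cos_sq θ
  have hid : (a1 * cos θ ^ 2 + a2 * cos θ * sin θ + a3 * sin θ ^ 2) * (a1 + a3) =
      (a1 * a3 - a2 ^ 2 / 4) * (sin θ ^ 2 + cos θ ^ 2) +
        ((a1 * cos θ + a2 * sin θ / 2) ^ 2 + (a3 * sin θ + a2 * cos θ / 2) ^ 2) := by ring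
  rw [hid, h, mul_one]
  exact le_add_of_nonneg_right (by positivity)

/-- The cubic part of the field on the equator, as a function of the longitude. -/
noncomputable def equatorCubic (a1 a2 a3 θ : ℝ) : ℝ :=
  cos θ * (a1 * cos θ ^ 2 + a2 * cos θ * sin θ + a3 * sin θ ^ 2)

/-- The linear part of the field on the equator, as a function of the longitude. -/
noncomputable def equatorLinear (b1 b2 θ : ℝ) : ℝ := b1 * cos θ + b2 * sin θ

theorem contDiff_equatorCubic (a1 a2 a3 : ℝ) : ContDiff ℝ 1 (equatorCubic a1 a2 a3) := by
  unfold equatorCubic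
  fun_prop

theorem contDiff_equatorLinear (b1 b2 : ℝ) : ContDiff ℝ 1 (equatorLinear b1 b2) := by
  unfold equatorLinear
  fun_prop

theorem antiperiodic_equatorCubic (a1 a2 a3 : ℝ) :
    Function.Antiperiodic (equatorCubic a1 a2 a3) π := by
  intro θ
  simp only [equatorCubic, cos_add_pi, sin_add_pi]
  ring

theorem antiperiodic_equatorLinear (b1 b2 : ℝ) :
    Function.Antiperiodic (equatorLinear b1 b2) π := by
  intro θ
  simp only [equatorLinear, cos_add_pi, sin_add_pi]
  ring

theorem equatorCubic_linear_lower_bound {a1 a2 a3 : ℝ} (hD : a2 ^ 2 - 4 * a1 * a3 < 0)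
    (ha1 : 0 < a1) : ∃ k > 0,
      (∀ θ, -(π / 2) ≤ θ → θ ≤ 0 → k * (θ + π / 2) ≤ equatorCubic a1 a2 a3 θ) ∧
      ∀ θ, 0 ≤ θ → θ ≤ π / 2 → k * (π / 2 - θ) ≤ equatorCubic a1 a2 a3 θ := by
  obtain ⟨q, hq, hqle⟩ := quadratic_trig_lower_bound hD ha1
  have hpi : 0 < 2 / π := by positivity
  refine ⟨2 / π * q, mul_pos hpi hq, fun θ h1 h2 => ?_, fun θ h1 h2 => ?_⟩
  · have hc := two_div_pi_mul_le_cos_left h1 h2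
    calc 2 / π * q * (θ + π / 2) = 2 / π * (θ + π / 2) * q := by ring
      _ ≤ _ := mul_le_mul hc (hqle θ) hq.le
        ((mul_nonneg hpi.le (by linarith)).trans hc)
  · have hc := two_div_pi_mul_le_cos_right h1 h2
    calc 2 / π * q * (π / 2 - θ) = 2 / π * (π / 2 - θ) * q := by ring
      _ ≤ _ := mul_le_mul hc (hqle θ) hq.le
        ((mul_nonneg hpi.le (by linarith)).trans hc)

theorem equator_profile_ne_zero_of_pos {b1 b2 a1 a2 a3 : ℝ} {u v : ℝ → ℝ}
    (hD : a2 ^ 2 - 4 * a1 * a3 < 0) (ha1 : 0 < a1) (hu : Continuous u)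
    (hv : ∀ θ, HasDerivAt v (-3 * (equatorLinear b1 b2 θ * u θ ^ 2 + equatorCubic a1 a2 a3 θ)) θ)
    (hvu : ∀ θ ∈ Icc (-(π / 2)) (π / 2), v θ = u θ ^ 3) (hanti : u (π / 2) = -u (-(π / 2))) :
    u (-(π / 2)) ≠ 0 := by
  obtain ⟨k, hk, hl, hr⟩ := equatorCubic_linear_lower_bound hD ha1
  obtain ⟨M, hM⟩ := (antiperiodic_equatorLinear b1 b2).periodic_two_mul.exists_abs_le
    two_pi_pos (contDiff_equatorLinear b1 b2).continuous
  have hmid : (-(π / 2) + π / 2) / 2 = 0 := by ring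
  refine profile_ne_zero_of_antiperiodic (by linarith [pi_pos]) hk hM ?_ ?_ hu hv hvu hanti
  · rw [hmid]
    intro θ hθ
    simpa using hl θ hθ.1 hθ.2
  · rw [hmid]
    exact fun θ hθ => hr θ hθ.1 hθ.2

theorem equator_profile_ne_zero {b1 b2 a1 a2 a3 : ℝ} {u v : ℝ → ℝ}
    (hD : a2 ^ 2 - 4 * a1 * a3 < 0) (hu : Continuous u)
    (hv : ∀ θ, HasDerivAt v (-3 * (equatorLinear b1 b2 θ * u θ ^ 2 + equatorCubic a1 a2 a3 θ)) θ)
    (hvu : ∀ θ ∈ Icc (-(π / 2)) (π / 2), v θ = u θ ^ 3) (hanti : u (π / 2) = -u (-(π / 2))) :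
    u (-(π / 2)) ≠ 0 := by
  rcases lt_trichotomy a1 0 with ha1 | ha1 | ha1
  · have h := equator_profile_ne_zero_of_pos (b1 := -b1) (b2 := -b2) (a1 := -a1) (a2 := -a2)
      (a3 := -a3) (u := -u) (v := -v) (by linarith) (by linarith) hu.neg (fun θ => ?_)
      (fun θ hθ => ?_) (by simp [hanti])
    · simpa using h
    · refine (hv θ).neg.congr_deriv ?_
      simp only [equatorLinear, equatorCubic, Pi.neg_apply]
      ring
    · simp only [Pi.neg_apply, hvu θ hθ]
      ring
  · subst ha1
    nlinarith [sq_nonneg a2]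
  · exact equator_profile_ne_zero_of_pos hD ha1 hu hv hvu hanti

theorem equatorCubic_ne_zero {a1 a2 a3 θ : ℝ} (hD : a2 ^ 2 - 4 * a1 * a3 < 0)
    (hθ : cos θ ≠ 0) : equatorCubic a1 a2 a3 θ ≠ 0 := by
  refine mul_ne_zero hθ fun h => ?_
  have hc : 0 < cos θ ^ 2 := by positivity
  have hid : 4 * a3 * (a1 * cos θ ^ 2 + a2 * cos θ * sin θ + a3 * sin θ ^ 2) =
      (2 * a3 * sin θ + a2 * cos θ) ^ 2 + (4 * a1 * a3 - a2 ^ 2) * cos θ ^ 2 := by ring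
  rw [h, mul_zero] at hid
  nlinarith [sq_nonneg (2 * a3 * sin θ + a2 * cos θ), mul_pos (sub_pos.2 hD) hc]

theorem hasDerivAt_inv_sqrt_one_add_sq {U : ℝ → ℝ} {U' t : ℝ} (hU : HasDerivAt U U' t) :
    HasDerivAt (fun t => (√(1 + U t ^ 2))⁻¹) (-(U t * U') * (√(1 + U t ^ 2))⁻¹ ^ 3) t := by
  have hpos : 0 < 1 + U t ^ 2 := by positivity
  have hs : √(1 + U t ^ 2) ≠ 0 := (Real.sqrt_pos.2 hpos).ne'
  have hsq : HasDerivAt (fun t => 1 + U t ^ 2) (2 * U t * U') t := by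
    simpa using (hU.fun_pow 2).const_add 1
  refine ((hsq.sqrt hpos.ne').fun_inv hs).congr_deriv ?_
  field_simp

theorem isSolutionS_of_cylinder {b1 b2 a1 a2 a3 : ℝ} {Θ U : ℝ → ℝ}
    (hΘ : ∀ t, HasDerivAt Θ (U t ^ 2 / (1 + U t ^ 2)) t)
    (hU : ∀ t, HasDerivAt U (-(equatorLinear b1 b2 (Θ t) * U t ^ 2 +
      equatorCubic a1 a2 a3 (Θ t)) / (1 + U t ^ 2)) t) :
    IsSolutionS b1 b2 a1 a2 a3 fun t => (cos (Θ t) * (√(1 + U t ^ 2))⁻¹,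
      sin (Θ t) * (√(1 + U t ^ 2))⁻¹, U t * (√(1 + U t ^ 2))⁻¹) := by
  intro t
  have hpos : 0 < 1 + U t ^ 2 := by positivity
  have hr := hasDerivAt_inv_sqrt_one_add_sq (hU t)
  have hrsq : (√(1 + U t ^ 2))⁻¹ ^ 2 = (1 + U t ^ 2)⁻¹ := by
    rw [inv_pow, Real.sq_sqrt hpos.le]
  refine (((hΘ t).cos.mul hr).prodMk (((hΘ t).sin.mul hr).prodMk ((hU t).mul hr))).congr_deriv ?_
  have hr1 : (√(1 + U t ^ 2))⁻¹ ^ 2 * (1 + U t ^ 2) = 1 := by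
    rw [hrsq, inv_mul_cancel₀ hpos.ne']
  simp only [div_eq_mul_inv, ← hrsq, Xfield, equatorLinear, equatorCubic]
  set r := (√(1 + U t ^ 2))⁻¹
  refine Prod.ext ?_ (Prod.ext ?_ ?_)
  · dsimp only
    ring
  · dsimp only
    ring
  · dsimp only
    have hz : (U t * r) ^ 2 - 1 = -r ^ 2 := by linear_combination hr1
    have hz' : r ^ 2 * U t ^ 2 = 1 - r ^ 2 := by linear_combination hr1
    rw [hz]
    linear_combination (r ^ 3 * ((b1 * cos (Θ t) + b2 * sin (Θ t)) * U t ^ 2 +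
      cos (Θ t) * (a1 * cos (Θ t) ^ 2 + a2 * cos (Θ t) * sin (Θ t) +
        a3 * sin (Θ t) ^ 2))) * hz'

end

theorem periodic_orbit_two_cusps (b1 b2 a1 a2 a3 : ℝ)
    (hD : a2^2 - 4*a1*a3 < 0) :
    ∃ T > (0:ℝ), ∃ f : ℝ → ℝ × ℝ × ℝ,
      IsSolutionS b1 b2 a1 a2 a3 f ∧
      (∀ t : ℝ, (f t).1^2 + (f t).2.1^2 + (f t).2.2^2 = 1) ∧
      (∀ t : ℝ, f (t + T) = -f t) ∧
      (∃ t0 : ℝ, (f t0).2.2 = 0 ∧ Xfield b1 b2 a1 a2 a3 (f t0) ≠ 0) := by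
  obtain ⟨M, hM⟩ := (antiperiodic_equatorCubic a1 a2 a3).periodic_two_mul.exists_abs_le
    Real.two_pi_pos (contDiff_equatorCubic a1 a2 a3).continuous
  obtain ⟨N, hN⟩ := (antiperiodic_equatorLinear b1 b2).periodic_two_mul.exists_abs_le
    Real.two_pi_pos (contDiff_equatorLinear b1 b2).continuous
  have hend : -(Real.pi / 2) + Real.pi = Real.pi / 2 := by ring
  obtain ⟨u, v, hu, hv, hvu, hanti⟩ := exists_antiperiodic_profile (M := max M N)
    (a := -(Real.pi / 2)) (b := Real.pi / 2)
    (contDiff_equatorCubic a1 a2 a3).continuous (contDiff_equatorLinear b1 b2).continuous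
    (fun θ => (hM θ).trans (le_max_left _ _)) (fun θ => (hN θ).trans (le_max_right _ _))
    (by linarith [Real.pi_pos])
  have hua := equator_profile_ne_zero hD hu hv hvu hanti
  obtain ⟨T, hT, Θ, U, hΘ, hU, hΘT, hUT, t0, hU0, hA0⟩ :=
    exists_antiperiodic_cylinder_solution (a := -(Real.pi / 2)) Real.pi_pos
      (contDiff_equatorCubic a1 a2 a3) (contDiff_equatorLinear b1 b2)
      (antiperiodic_equatorCubic a1 a2 a3) (antiperiodic_equatorLinear b1 b2) hu hv
      (by rwa [hend]) (by rwa [hend]) (by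
        rw [hend]
        intro θ hθ h0
        refine equatorCubic_ne_zero hD (Real.cos_pos_of_mem_Ioo ⟨?_, ?_⟩).ne'
        · exact lt_of_le_of_ne hθ.1 fun h => hua (by rw [h, h0])
        · refine lt_of_le_of_ne hθ.2 fun h => hua ?_
          rw [h, hanti] at h0
          linarith)
  refine ⟨T, hT, _, isSolutionS_of_cylinder hΘ hU, fun t => ?_, fun t => ?_, t0, ?_, fun h => ?_⟩
  · have hpos : 0 < 1 + U t ^ 2 := by positivity
    have hr : (√(1 + U t ^ 2))⁻¹ ^ 2 * (1 + U t ^ 2) = 1 := by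
      rw [inv_pow, Real.sq_sqrt hpos.le, inv_mul_cancel₀ hpos.ne']
    linear_combination hr + (√(1 + U t ^ 2))⁻¹ ^ 2 * Real.cos_sq_add_sin_sq (Θ t)
  · simp [hΘT, hUT, Real.cos_add_pi, Real.sin_add_pi]
  · simp [hU0]
  · have h3 := congrArg (fun z : ℝ × ℝ × ℝ => z.2.2) h
    refine hA0 ?_
    simp [Xfield, hU0] at h3
    rw [equatorCubic]
    linear_combination -h3
end
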